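/- arXiv:1611.06842 — 2 statements merged into one kernel-verified Lean document; each statement's English description precedes it below -/
import Mathlib

section
/- Let P be a finite poset with a unique maximal element and a unique minimal element. Then there exists a constant c = c(P) such that for every positive integer n, there exists a subset S of the Boolean lattice 2^[n] with |S| ≤ c such that 2^[n] \ S can be partitioned into copies of P (i.e., there is a family of pairwise disjoint copies of P in 2^[n] whose union is 2^[n] \ S). -/
/-- A subset `A` of a poset `Q` is a *copy* of the poset `P` if the subposet of `Q`
induced on `A` is order-isomorphic to `P`. -/
def IsCopy (P : Type*) [PartialOrder P] {Q : Type*} [PartialOrder Q] (A : Set Q) : Prop :=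
  Nonempty (P ≃o A)

/-- The subset `T` of a poset `Q` is *partitioned into copies of `P`* if there is a family
of pairwise disjoint copies of `P` in `Q` whose union is `T`. -/
def PartitionedIntoCopies (P : Type*) [PartialOrder P] {Q : Type*} [PartialOrder Q]
    (T : Set Q) : Prop :=
  ∃ 𝒞 : Set (Set Q), (∀ A ∈ 𝒞, IsCopy P A) ∧ 𝒞.PairwiseDisjoint id ∧ ⋃₀ 𝒞 = T


universe u v w

section Basic
variable {P : Type u} [PartialOrder P]

theorem tiled_empty {Q : Type v} [PartialOrder Q] : PartitionedIntoCopies P (∅ : Set Q) :=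
  ⟨∅, by simp, by simp, by simp⟩

theorem tiled_range {Q : Type v} [PartialOrder Q] (f : P ↪o Q) :
    PartitionedIntoCopies P (Set.range f) :=
  ⟨{Set.range f}, by
    rintro A rfl
    exact ⟨f.orderIso⟩, by simp, by simp⟩

theorem tiled_iUnion {Q : Type v} [PartialOrder Q] {ι : Type w} (T : ι → Set Q)
    (hT : ∀ i, PartitionedIntoCopies P (T i)) (hd : Pairwise (Function.onFun Disjoint T)) :
    PartitionedIntoCopies P (⋃ i, T i) := by
  choose C h1 h2 h3 using hT
  refine ⟨⋃ i, C i, ?_, ?_, ?_⟩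
  · intro A hA
    obtain ⟨i, hi⟩ := Set.mem_iUnion.1 hA
    exact h1 i A hi
  · intro A hA B hB hAB
    obtain ⟨i, hi⟩ := Set.mem_iUnion.1 hA
    obtain ⟨j, hj⟩ := Set.mem_iUnion.1 hB
    by_cases hij : i = j
    · subst hij
      exact h2 i hi hj hAB
    · have hA' : A ⊆ T i := by rw [← h3 i]; exact Set.subset_sUnion_of_mem hi
      have hB' : B ⊆ T j := by rw [← h3 j]; exact Set.subset_sUnion_of_mem hj
      exact (hd hij).mono hA' hB'
  · rw [Set.sUnion_iUnion]
    exact Set.iUnion_congr h3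

theorem tiled_union {Q : Type v} [PartialOrder Q] {S T : Set Q}
    (hS : PartitionedIntoCopies P S) (hT : PartitionedIntoCopies P T) (hd : Disjoint S T) :
    PartitionedIntoCopies P (S ∪ T) := by
  have := tiled_iUnion (P := P) (fun b : Bool => cond b S T) (by rintro (_ | _) <;> assumption)
    (by
      rintro (_ | _) (_ | _) h
      · exact absurd rfl h
      · exact hd.symm
      · exact hd
      · exact absurd rfl h)
  rwa [Set.union_eq_iUnion]

theorem tiled_image {Q : Type v} [PartialOrder Q] {Q' : Type w} [PartialOrder Q'] (f : Q ↪o Q')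
    {T : Set Q} (hT : PartitionedIntoCopies P T) : PartitionedIntoCopies P (f '' T) := by
  obtain ⟨C, h1, h2, h3⟩ := hT
  refine ⟨(fun A => f '' A) '' C, ?_, ?_, ?_⟩
  · rintro _ ⟨A, hA, rfl⟩
    obtain ⟨g⟩ := h1 A hA
    let k : P ↪o Q' := g.toOrderEmbedding.trans ((OrderEmbedding.subtype A).trans f)
    refine ⟨(OrderEmbedding.orderIso (f := k)).trans (OrderIso.setCongr _ _ ?_)⟩
    ext x
    constructor
    · rintro ⟨p, rfl⟩
      exact ⟨_, (g p).2, rfl⟩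
    · rintro ⟨a, ha, rfl⟩
      obtain ⟨p, hp⟩ := g.surjective ⟨a, ha⟩
      exact ⟨p, by simp [k, hp]; rfl⟩
  · rintro _ ⟨A, hA, rfl⟩ _ ⟨B, hB, rfl⟩ hAB
    have : A ≠ B := fun h => hAB (by rw [h])
    exact Set.disjoint_image_of_injective f.injective (h2 hA hB this)
  · rw [← h3, Set.sUnion_image, Set.sUnion_eq_biUnion, Set.image_iUnion₂]

theorem tiled_iso {Q : Type v} [PartialOrder Q] {Q' : Type w} [PartialOrder Q'] (f : Q ≃o Q')
    {T : Set Q} (hT : PartitionedIntoCopies P T) : PartitionedIntoCopies P (f '' T) :=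
  tiled_image f.toOrderEmbedding hT

/-- A poset isomorphic to a finite Boolean lattice of dimension `n`. -/
def IsCube (Q : Type v) [PartialOrder Q] (n : ℕ) : Prop := Nonempty (Q ≃o Set (Fin n))

theorem isCube_set (α : Type v) [Fintype α] : IsCube (Set α) (Fintype.card α) :=
  ⟨(Fintype.equivFin α).toOrderIsoSet⟩

theorem isCube_finset (α : Type v) [Fintype α] : IsCube (Finset α) (Fintype.card α) :=
  ⟨(Fintype.finsetOrderIsoSet (α := α)).trans (Fintype.equivFin α).toOrderIsoSet⟩

theorem IsCube.prod {Q : Type v} [PartialOrder Q] {Q' : Type w} [PartialOrder Q'] {m n : ℕ}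
    (h : IsCube Q m) (h' : IsCube Q' n) : IsCube (Q × Q') (m + n) := by
  obtain ⟨f⟩ := h
  obtain ⟨g⟩ := h'
  have := isCube_set (Fin m ⊕ Fin n)
  simp only [Fintype.card_sum, Fintype.card_fin] at this
  obtain ⟨e⟩ := this
  have k : Q × Q' ≃o Set (Fin m) × Set (Fin n) :=
    { toEquiv := f.toEquiv.prodCongr g.toEquiv
      map_rel_iff' := by rintro ⟨a, b⟩ ⟨c, d⟩; simp }
  exact ⟨k.trans (Set.sumEquiv.symm.trans e)⟩

theorem tiled_topswap {Q : Type v} [PartialOrder Q] [OrderTop P] (g : P → Q)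
    (hg : ∀ q q', q ≠ ⊤ → q' ≠ ⊤ → (g q ≤ g q' ↔ q ≤ q')) (y : Q) (hy : ∀ q, q ≠ ⊤ → g q < y) :
    PartitionedIntoCopies P (insert y (g '' {q | q ≠ ⊤})) := by
  classical
  let f : P → Q := fun q => if q = ⊤ then y else g q
  have hf : ∀ q q', f q ≤ f q' ↔ q ≤ q' := by
    intro q q'
    by_cases h : q = ⊤ <;> by_cases h' : q' = ⊤
    · simp [f, h, h']
    · simp only [f, h, h', if_true, if_false, top_le_iff, iff_false]
      exact (hy q' h').not_ge
    · simp only [f, h, h', if_true, if_false, le_top, iff_true]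
      exact (hy q h).le
    · simp only [f, h, h', if_false]
      exact hg q q' h h'
  have := tiled_range (P := P) (OrderEmbedding.ofMapLEIff f hf)
  convert this using 1
  ext z
  simp only [Set.mem_insert_iff, Set.mem_image, Set.mem_ofPred_eq, Set.mem_range,
    OrderEmbedding.coe_ofMapLEIff]
  constructor
  · rintro (rfl | ⟨q, hq, rfl⟩)
    · exact ⟨⊤, by simp [f]⟩
    · exact ⟨q, by simp [f, hq]⟩
  · rintro ⟨q, rfl⟩
    by_cases h : q = ⊤
    · left; simp [f, h]
    · right; exact ⟨q, h, by simp [f, h]⟩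

theorem tiled_botswap {Q : Type v} [PartialOrder Q] [OrderBot P] (g : P → Q)
    (hg : ∀ q q', q ≠ ⊥ → q' ≠ ⊥ → (g q ≤ g q' ↔ q ≤ q')) (y : Q) (hy : ∀ q, q ≠ ⊥ → y < g q) :
    PartitionedIntoCopies P (insert y (g '' {q | q ≠ ⊥})) := by
  classical
  let f : P → Q := fun q => if q = ⊥ then y else g q
  have hf : ∀ q q', f q ≤ f q' ↔ q ≤ q' := by
    intro q q'
    by_cases h : q = ⊥ <;> by_cases h' : q' = ⊥
    · simp [f, h, h']
    · simp only [f, h, h', if_true, if_false, bot_le, iff_true]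
      exact (hy q' h').le
    · simp only [f, h, h', if_true, if_false, le_bot_iff, iff_false]
      exact (hy q h).not_ge
    · simp only [f, h, h', if_false]
      exact hg q q' h h'
  have := tiled_range (P := P) (OrderEmbedding.ofMapLEIff f hf)
  convert this using 1
  ext z
  simp only [Set.mem_insert_iff, Set.mem_image, Set.mem_ofPred_eq, Set.mem_range,
    OrderEmbedding.coe_ofMapLEIff]
  constructor
  · rintro (rfl | ⟨q, hq, rfl⟩)
    · exact ⟨⊥, by simp [f]⟩
    · exact ⟨q, by simp [f, hq]⟩
  · rintro ⟨q, rfl⟩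
    by_cases h : q = ⊥
    · left; simp [f, h]
    · right; exact ⟨q, h, by simp [f, h]⟩

/-- Final induction: if `2^[M]` minus a copy of `2^[b]` is tiled, with `b < M`, we are done. -/
theorem induct_cube {M b : ℕ} (hbM : b < M) (f : Set (Fin b) ↪o Set (Fin M))
    (hf : PartitionedIntoCopies P (Set.range f)ᶜ) (n : ℕ) :
    ∃ S : Set (Set (Fin n)), S.ncard ≤ 2 ^ M ∧ PartitionedIntoCopies P Sᶜ := by
  induction n using Nat.strong_induction_on with
  | _ n ih =>
  by_cases hn : n < M
  · refine ⟨Set.univ, ?_, ?_⟩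
    · rw [Set.ncard_univ, Nat.card_eq_fintype_card, Fintype.card_set, Fintype.card_fin]
      exact Nat.pow_le_pow_right (by norm_num) hn.le
    · rw [Set.compl_univ]; exact tiled_empty
  · push Not at hn
    obtain ⟨S, hS, hT⟩ := ih (b + (n - M)) (by omega)
    obtain ⟨e⟩ := (IsCube.prod ⟨OrderIso.refl _⟩ ⟨OrderIso.refl _⟩ :
      IsCube (Set (Fin b) × Set (Fin (n - M))) (b + (n - M)))
    obtain ⟨e'⟩ := (IsCube.prod ⟨OrderIso.refl _⟩ ⟨OrderIso.refl _⟩ :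
      IsCube (Set (Fin M) × Set (Fin (n - M))) (M + (n - M)))
    rw [show M + (n - M) = n by omega] at e'
    let F : Set (Fin b) × Set (Fin (n - M)) ↪o Set (Fin M) × Set (Fin (n - M)) :=
      OrderEmbedding.ofMapLEIff (fun z => (f z.1, z.2)) (by
        rintro ⟨a, c⟩ ⟨a', c'⟩; simp)
    let G : Set (Fin (b + (n - M))) ↪o Set (Fin n) :=
      e.symm.toOrderEmbedding.trans (F.trans e'.toOrderEmbedding)
    refine ⟨G '' S, ?_, ?_⟩
    · rw [Set.ncard_image_of_injective _ G.injective]; exact hS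
    · have h1 : PartitionedIntoCopies P (G '' Sᶜ) := tiled_image G hT
      have h2 : PartitionedIntoCopies P (Set.range G)ᶜ := by
        have h3 : PartitionedIntoCopies P (⋃ c : Set (Fin (n - M)),
            (fun a => e' (a, c)) '' (Set.range f)ᶜ) := by
          apply tiled_iUnion
          · intro c
            exact tiled_image (OrderEmbedding.ofMapLEIff (fun a => e' (a, c)) (by simp)) hf
          · intro c c' hc
            rw [Function.onFun, Set.disjoint_left]
            rintro _ ⟨a, ha, rfl⟩ ⟨a', ha', h⟩
            apply hc
            have := e'.injective h
            simp only [Prod.mk.injEq] at this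
            exact this.2.symm
        convert h3 using 1
        ext z
        obtain ⟨⟨a, c⟩, rfl⟩ := e'.surjective z
        simp only [Set.mem_compl_iff, Set.mem_range, not_exists, Set.mem_iUnion, Set.mem_image,
          EmbeddingLike.apply_eq_iff_eq, Prod.mk.injEq]
        constructor
        · intro h
          refine ⟨c, a, ?_, rfl, rfl⟩
          intro x hx
          apply h (e (x, c))
          simp [G, F, hx]
        · rintro ⟨c', a', h, rfl, rfl⟩ x hx
          apply h (e.symm x).1
          simp only [G, F, RelEmbedding.trans_apply, OrderIso.coe_toOrderEmbedding,
            OrderEmbedding.coe_ofMapLEIff, EmbeddingLike.apply_eq_iff_eq, Prod.mk.injEq] at hx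
          exact hx.1
      have := tiled_union h1 h2 (by
        rw [Set.disjoint_compl_right_iff_subset]; exact Set.image_subset_range _ _)
      convert this using 1
      ext z
      simp only [Set.mem_compl_iff, Set.mem_union, Set.mem_image, Set.mem_range]
      constructor
      · intro h
        by_cases hz : ∃ y, G y = z
        · left
          obtain ⟨y, rfl⟩ := hz
          exact ⟨y, fun hy => h ⟨y, hy, rfl⟩, rfl⟩
        · right; exact hz
      · rintro (⟨y, hy, rfl⟩ | h)
        · rintro ⟨y', hy', h'⟩
          rw [G.injective h'] at hy'
          exact hy hy'
        · rintro ⟨y, hy, h'⟩; exact h ⟨y, h'⟩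

end Basic


section Fiber
variable {P : Type u} [PartialOrder P]

/-- Reduction along fibres: a uniform `r`-fold cover of the cube `X` by copies of `P`. -/
theorem fiber_lemma {X : Type u} [PartialOrder X] {m : ℕ} (hX : IsCube X m)
    {ι : Type v} [Fintype ι] (a : ι → P ↪o X) (r : ℕ)
    (ha : ∀ x, Nat.card {i // x ∈ Set.range (a i)} = r)
    {Y : Type w} [PartialOrder Y] (R : Set Y) (n : ℕ) (hn : Fintype.card ι ≤ n + r)
    (hR : ∀ W : Finset Y, Disjoint (W : Set Y) R → W.card = n →
      PartitionedIntoCopies P ((W : Set Y) ∪ R)) (j : ℕ) :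
    ∃ (Q : Type u) (_ : PartialOrder Q) (b : ℕ), IsCube Q b ∧
      ∀ Z : Finset Y, Disjoint (Z : Set Y) R → Z.card = n + r * j →
        PartitionedIntoCopies P ((Set.univ : Set Q) ×ˢ ((Z : Set Y) ∪ R)) := by
  classical
  induction j with
  | zero =>
    obtain ⟨e⟩ := isCube_set PEmpty.{u+1}
    refine ⟨Set PEmpty.{u+1}, inferInstance, _, ⟨e⟩, ?_⟩
    intro Z hd hZ
    have h := hR Z hd (by simpa using hZ)
    have h2 := tiled_image (P := P) (OrderEmbedding.ofMapLEIff
      (fun y : Y => ((∅ : Set PEmpty.{u+1}), y)) (by simp)) h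
    convert h2 using 1
    ext ⟨q, y⟩
    have : q = ∅ := Subsingleton.elim _ _
    subst this
    simp
  | succ j ih =>
    obtain ⟨Q, hQ, b, hb, ih⟩ := ih
    refine ⟨X × Q, inferInstance, _, hX.prod hb, ?_⟩
    intro Z hd hZ
    have hcard : Fintype.card ι ≤ Fintype.card Z := by
      rw [Fintype.card_coe, hZ, mul_add]; omega
    obtain ⟨g⟩ := Function.Embedding.nonempty_of_card_le hcard
    let y : ι → Y := fun i => (g i : Y)
    have hy : Function.Injective y := fun i i' h => g.injective (Subtype.ext h)
    have hyZ : ∀ i, y i ∈ Z := fun i => (g i).2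
    -- the part of `Z` left for the fibre over `x`
    let C : X → Finset Y := fun x => (Finset.univ.filter (fun i => x ∈ Set.range (a i))).image y
    have hC : ∀ x, (C x).card = r := by
      intro x
      rw [Finset.card_image_of_injective _ hy, ← ha x, Nat.card_eq_fintype_card,
        Fintype.card_subtype]
    have hCZ : ∀ x, C x ⊆ Z := by
      intro x z hz
      obtain ⟨i, _, rfl⟩ := Finset.mem_image.1 hz
      exact hyZ i
    have hmemC : ∀ x z, z ∈ C x ↔ ∃ i, x ∈ Set.range (a i) ∧ y i = z := by
      intro x z
      simp [C]
    have h1 : PartitionedIntoCopies P (⋃ iq : ι × Q,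
        Set.range (fun p : P => (((a iq.1 p, iq.2), y iq.1) : (X × Q) × Y))) := by
      apply tiled_iUnion
      · rintro ⟨i, q⟩
        exact tiled_range (OrderEmbedding.ofMapLEIff
          (fun p : P => (((a i p, q), y i) : (X × Q) × Y)) (by simp))
      · rintro ⟨i, q⟩ ⟨i', q'⟩ hne
        rw [Function.onFun, Set.disjoint_left]
        rintro _ ⟨p, rfl⟩ ⟨p', h⟩
        simp only [Prod.mk.injEq] at h
        exact hne (by rw [Prod.mk.injEq]; exact ⟨(hy h.2).symm, h.1.2.symm⟩)
    have h2 : PartitionedIntoCopies P (⋃ x : X,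
        (fun z : Q × Y => (((x, z.1), z.2) : (X × Q) × Y)) ''
          ((Set.univ : Set Q) ×ˢ (((Z \ C x : Finset Y) : Set Y) ∪ R))) := by
      apply tiled_iUnion
      · intro x
        refine tiled_image (OrderEmbedding.ofMapLEIff
          (fun z : Q × Y => (((x, z.1), z.2) : (X × Q) × Y)) ?_) (ih _ ?_ ?_)
        · rintro ⟨q, z⟩ ⟨q', z'⟩; simp
        · exact hd.mono_left (by exact_mod_cast Finset.sdiff_subset)
        · rw [Finset.card_sdiff_of_subset (hCZ x), hC, hZ, mul_add]; omega
      · intro x x' hne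
        rw [Function.onFun, Set.disjoint_left]
        rintro _ ⟨z, _, rfl⟩ ⟨z', _, h⟩
        simp only [Prod.mk.injEq] at h
        exact hne h.1.1.symm
    have h3 := tiled_union h1 h2 (by
      rw [Set.disjoint_left]
      rintro ⟨⟨x, q⟩, z⟩ hz hz'
      simp only [Set.mem_iUnion, Set.mem_range, Prod.mk.injEq, Prod.exists] at hz
      obtain ⟨i, q, p, ⟨rfl, rfl⟩, rfl⟩ := hz
      simp only [Set.mem_iUnion, Set.mem_image, Prod.mk.injEq, Prod.exists] at hz'
      obtain ⟨x, q', z, hz, ⟨rfl, rfl⟩, rfl⟩ := hz'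
      simp only [Set.mem_prod, Set.mem_univ, true_and, Set.mem_union, Finset.coe_sdiff,
        Set.mem_sdiff, Finset.mem_coe, hmemC] at hz
      rcases hz with hz | hz
      · exact hz.2 ⟨i, ⟨p, rfl⟩, rfl⟩
      · exact Set.disjoint_left.1 hd (hyZ i) hz)
    convert h3 using 1
    ext ⟨⟨x, q⟩, z⟩
    simp only [Set.mem_prod, Set.mem_univ, true_and, Set.mem_union, Finset.coe_sdiff,
        Set.mem_sdiff, Finset.mem_coe, hmemC, Set.mem_iUnion, Set.mem_image, Set.mem_range,
        Prod.mk.injEq, Prod.exists]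
    constructor
    · rintro (h | h)
      · by_cases hz : ∃ i, x ∈ Set.range (a i) ∧ y i = z
        · left
          obtain ⟨i, ⟨p, hp⟩, hi⟩ := hz
          exact ⟨i, q, p, ⟨hp, rfl⟩, hi⟩
        · right
          exact ⟨x, q, z, Or.inl ⟨h, hz⟩, ⟨rfl, rfl⟩, rfl⟩
      · right
        exact ⟨x, q, z, Or.inr h, ⟨rfl, rfl⟩, rfl⟩
    · rintro (⟨i, q', p, ⟨rfl, rfl⟩, rfl⟩ | ⟨x', q', z', h, ⟨rfl, rfl⟩, rfl⟩)
      · left; exact hyZ i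
      · rcases h with h | h
        · left; exact h.1
        · right; exact h

end Fiber


section Cover

theorem exists_sort {S : Type v} [Fintype S] (f : S → ℕ) :
    ∃ e : Fin (Fintype.card S) ≃ S, Monotone (f ∘ e) := by
  let e0 := (Fintype.equivFin S).symm
  refine ⟨(Tuple.sort (f ∘ e0)).trans e0, ?_⟩
  have := Tuple.monotone_sort (f ∘ e0)
  intro i j h
  exact this h

theorem centralBinom_sq (n : ℕ) : (2 * n + 1) * n.centralBinom ^ 2 ≤ 16 ^ n := by
  induction n with
  | zero => simp
  | succ n ih =>
    have h := Nat.succ_mul_centralBinom_succ n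
    have h2 : (n + 1) ^ 2 * ((2 * (n + 1) + 1) * (n + 1).centralBinom ^ 2)
        ≤ (n + 1) ^ 2 * 16 ^ (n + 1) := by
      calc (n + 1) ^ 2 * ((2 * (n + 1) + 1) * (n + 1).centralBinom ^ 2)
          = (2 * n + 3) * ((n + 1) * (n + 1).centralBinom) ^ 2 := by ring
        _ = (4 * ((2 * n + 3) * (2 * n + 1))) * ((2 * n + 1) * n.centralBinom ^ 2) := by
            rw [h]; ring
        _ ≤ (16 * (n + 1) ^ 2) * 16 ^ n := Nat.mul_le_mul (by nlinarith) ih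
        _ = _ := by ring
    exact Nat.le_of_mul_le_mul_left h2 (by positivity)

theorem exists_centralBinom_le (c : ℕ) : ∃ n, c ≤ n ∧ c * n.centralBinom ≤ 2 ^ (2 * n) := by
  refine ⟨c ^ 2 + c, by nlinarith, ?_⟩
  have h := centralBinom_sq (c ^ 2 + c)
  set n := c ^ 2 + c
  have h1 : (c * n.centralBinom) ^ 2 ≤ (2 ^ (2 * n)) ^ 2 := by
    calc (c * n.centralBinom) ^ 2 = c ^ 2 * n.centralBinom ^ 2 := by ring
      _ ≤ (2 * n + 1) * n.centralBinom ^ 2 := Nat.mul_le_mul_right _ (by simp only [n]; nlinarith)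
      _ ≤ 16 ^ n := h
      _ = (2 ^ (2 * n)) ^ 2 := by rw [← pow_mul, mul_comm 2 n, mul_assoc, mul_comm n, pow_mul]
                                  norm_num
  exact (Nat.pow_le_pow_iff_left (by norm_num)).1 h1

/-- In a size-sorted listing of all subsets, far apart sets have sizes that are far apart. -/
theorem sorted_gap {α : Type v} [Fintype α] {n : ℕ} (hα : Fintype.card α = 2 * n)
    {N : ℕ} (e : Fin N ≃ Finset α) (he : Monotone (Finset.card ∘ e)) (g : ℕ)
    (v v' : Fin N) (h : (v : ℕ) + g * n.centralBinom ≤ v') :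
    (e v).card + g ≤ (e v').card := by
  classical
  by_contra hlt
  push Not at hlt
  have hvv : v ≤ v' := by rw [Fin.le_def]; omega
  have h1 : ((Finset.Icc v v').map e.toEmbedding) ⊆
      (Finset.range g).biUnion (fun i => Finset.powersetCard ((e v).card + i) Finset.univ) := by
    intro s hs
    obtain ⟨x, hx, rfl⟩ := Finset.mem_map.1 hs
    rw [Finset.mem_Icc] at hx
    have h2 := he hx.1
    have h3 := he hx.2
    simp only [Function.comp] at h2 h3
    simp only [Finset.mem_biUnion, Finset.mem_range, Finset.mem_powersetCard_univ]
    exact ⟨(e x).card - (e v).card, by omega, by simp; omega⟩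
  have h4 := Finset.card_le_card h1
  rw [Finset.card_map, Fin.card_Icc] at h4
  have h5 : ((Finset.range g).biUnion
      (fun i => Finset.powersetCard ((e v).card + i) (Finset.univ : Finset α))).card
      ≤ g * n.centralBinom := by
    have := Finset.card_biUnion_le_card_mul (Finset.range g)
      (fun i => Finset.powersetCard ((e v).card + i) (Finset.univ : Finset α)) n.centralBinom
      (by
        intro i _
        rw [Finset.card_powersetCard, Finset.card_univ, hα]
        exact Nat.choose_le_centralBinom _ _)
    simpa using this
  omega

/-- Copies of `P` with prescribed level sequence with large gaps. -/
theorem exists_copy_levels {P : Type u} [PartialOrder P] [Fintype P] [BoundedOrder P]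
    (τ : Fin (Fintype.card P) ≃ P) (hτ : ∀ x y, x ≤ y → τ.symm x ≤ τ.symm y) (m0 : ℕ)
    (ℓ : Fin (Fintype.card P) → ℕ) (hℓ : ∀ k k', k < k' → ℓ k + Fintype.card P ≤ ℓ k')
    (hm : ∀ k, ℓ k + 1 ≤ Fintype.card P + m0) :
    ∃ φ : P ↪o Finset ({x : P // x ≠ ⊥} ⊕ Fin m0), ∀ k, (φ (τ k)).card = ℓ k := by
  classical
  let d : P → Finset {x : P // x ≠ ⊥} := fun x => Finset.univ.filter (fun z => (z : P) ≤ x)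
  have hcard : Fintype.card {x : P // x ≠ ⊥} + 1 = Fintype.card P := by
    have := Fintype.card_subtype_compl (fun x : P => x = ⊥)
    have hp : 0 < Fintype.card P := Fintype.card_pos
    simp only [Fintype.card_subtype_eq] at this
    rw [this]; omega
  have hd : ∀ x, (d x).card + 1 ≤ Fintype.card P := by
    intro x
    have := Finset.card_le_univ (d x)
    omega
  let L : P → ℕ := fun x => ℓ (τ.symm x)
  have hL : ∀ x y, x < y → L x + Fintype.card P ≤ L y := by
    intro x y h
    apply hℓ
    exact lt_of_le_of_ne (hτ x y h.le) (fun h' => h.ne (τ.symm.injective h'))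
  have hdL : ∀ x, (d x).card ≤ L x := by
    intro x
    by_cases hx : x = ⊥
    · subst hx
      have : d ⊥ = ∅ := by
        ext z
        simp [d, z.2]
      simp [this]
    · have := hL ⊥ x (bot_lt_iff_ne_bot.2 hx)
      have := hd x
      omega
  have hLm : ∀ x, L x ≤ (d x).card + m0 := by
    intro x
    by_cases hx : x = ⊤
    · subst hx
      have : d ⊤ = Finset.univ := by
        ext z
        simp [d]
      rw [this, Finset.card_univ]
      have := hm (τ.symm ⊤)
      simp only [L]
      omega
    · have := hL x ⊤ (lt_top_iff_ne_top.2 hx)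
      have := hm (τ.symm ⊤)
      simp only [L] at *
      omega
  let N : P → ℕ := fun x => L x - (d x).card
  have hN : ∀ x y, x ≤ y → N x ≤ N y := by
    intro x y h
    rcases h.eq_or_lt with rfl | h
    · exact le_rfl
    · have := hL x y h
      have := hd y
      have := hdL x
      simp only [N]
      omega
  let f : P → Finset ({x : P // x ≠ ⊥} ⊕ Fin m0) := fun x =>
    (d x).disjSum (Finset.univ.filter (fun i : Fin m0 => (i : ℕ) < N x))
  have hf : ∀ x y, f x ≤ f y ↔ x ≤ y := by
    intro x y
    constructor
    · intro h
      by_cases hx : x = ⊥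
      · subst hx; exact bot_le
      · have h1 : Sum.inl ⟨x, hx⟩ ∈ f x := by simp [f, d]
        have h2 := h h1
        simpa [f, d] using h2
    · intro h z hz
      rcases z with z | z
      · simp only [f, d, Finset.inl_mem_disjSum, Finset.mem_filter, Finset.mem_univ,
          true_and] at hz ⊢
        exact hz.trans h
      · simp only [f, d, Finset.inr_mem_disjSum, Finset.mem_filter, Finset.mem_univ,
          true_and] at hz ⊢
        exact hz.trans_le (hN x y h)
  refine ⟨OrderEmbedding.ofMapLEIff f hf, ?_⟩
  intro k
  have h1 : (Finset.univ.filter (fun i : Fin m0 => (i : ℕ) < N (τ k))).card = N (τ k) := by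
    have : N (τ k) ≤ m0 := by
      have := hLm (τ k)
      simp only [N]; omega
    rw [Fin.card_filter_val_lt, min_eq_right this]
  simp only [OrderEmbedding.coe_ofMapLEIff, f, Finset.card_disjSum, h1]
  have := hdL (τ k)
  have h2 : L (τ k) = ℓ k := by simp [L]
  simp only [N]
  omega

theorem exists_perm_map {α : Type v} [Fintype α] [DecidableEq α] (s s' : Finset α)
    (h : s.card = s'.card) : ∃ π : Equiv.Perm α, s.map π.toEmbedding = s' := by
  have e : {x // x ∈ s} ≃ {x // x ∈ s'} := Finset.equivOfCardEq h
  refine ⟨e.extendSubtype, ?_⟩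
  apply Finset.eq_of_subset_of_card_le
  · intro x hx
    obtain ⟨y, hy, rfl⟩ := Finset.mem_map.1 hx
    exact e.extendSubtype_mem y hy
  · rw [Finset.card_map, h]

theorem card_perm_congr {α : Type v} [Fintype α] [DecidableEq α] (s s' X : Finset α)
    (h : s.card = s'.card) :
    (Finset.univ.filter (fun σ : Equiv.Perm α => s.map σ.toEmbedding = X)).card =
    (Finset.univ.filter (fun σ : Equiv.Perm α => s'.map σ.toEmbedding = X)).card := by
  obtain ⟨π, rfl⟩ := exists_perm_map s s' h
  refine Finset.card_bij' (fun σ _ => π.symm.trans σ) (fun σ _ => π.trans σ) ?_ ?_ ?_ ?_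
  · intro σ hσ
    simp only [Finset.mem_filter, Finset.mem_univ, true_and] at hσ ⊢
    rw [← hσ, Finset.map_map]
    congr 1
    ext x; simp
  · intro σ hσ
    simp only [Finset.mem_filter, Finset.mem_univ, true_and] at hσ ⊢
    rw [← hσ, Finset.map_map]
    congr 1
  · intro σ _; ext x; simp
  · intro σ _; ext x; simp

/-- Uniform cover of some Boolean lattice by copies of `P`. -/
theorem exists_uniform_cover (P : Type u) [PartialOrder P] [Fintype P] [BoundedOrder P] :
    ∃ (X : Type u) (_ : PartialOrder X) (m : ℕ) (_ : IsCube X m) (ι : Type u) (_ : Fintype ι)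
      (a : ι → P ↪o X) (r : ℕ), 0 < r ∧ ∀ x, Nat.card {i // x ∈ Set.range (a i)} = r := by
  classical
  set p := Fintype.card P with hp
  have hp0 : 0 < p := Fintype.card_pos
  obtain ⟨n, hn, hn2⟩ := exists_centralBinom_le (p * p)
  have hpn : p ≤ n := le_trans (Nat.le_mul_self p) hn
  let m0 := 2 * n - (p - 1)
  let α := {x : P // x ≠ ⊥} ⊕ Fin m0
  have hα : Fintype.card α = 2 * n := by
    have h1 := Fintype.card_subtype_compl (fun x : P => x = ⊥)
    simp only [Fintype.card_subtype_eq] at h1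
    have h2 : Fintype.card α = Fintype.card {x : P // x ≠ ⊥} + m0 := by
      simp only [α, Fintype.card_sum, Fintype.card_fin]
    rw [h2, h1]
    simp only [m0]
    omega
  let N := Fintype.card (Finset α)
  have hN : N = 2 ^ (2 * n) := by simp only [N, Fintype.card_finset, hα]
  obtain ⟨e, he⟩ := exists_sort (fun s : Finset α => s.card)
  obtain ⟨τ, hτ0⟩ := exists_sort (fun x : P => (Finset.univ.filter (fun z : P => z ≤ x)).card)
  have hτ : ∀ x y, x ≤ y → τ.symm x ≤ τ.symm y := by
    intro x y hxy
    by_contra hlt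
    push Not at hlt
    have h1 := hτ0 hlt.le
    simp only [Function.comp, Equiv.apply_symm_apply] at h1
    have hne : x ≠ y := by rintro rfl; exact lt_irrefl _ hlt
    have hlt' := lt_of_le_of_ne hxy hne
    have h2 : (Finset.univ.filter (fun z : P => z ≤ x)) ⊂
        (Finset.univ.filter (fun z : P => z ≤ y)) := by
      rw [Finset.ssubset_iff_of_subset]
      · exact ⟨y, by simp, by simpa using hlt'.not_ge⟩
      · intro z hz
        simp only [Finset.mem_filter, Finset.mem_univ, true_and] at hz ⊢
        exact hz.trans hxy
    exact absurd h1 (not_le.2 (Finset.card_lt_card h2))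
  -- positions
  let pos : Fin p × Fin N ≃ Fin N × Fin p :=
    finProdFinEquiv.trans ((finCongr (mul_comm p N)).trans finProdFinEquiv.symm)
  let idx : Fin N → Fin p → Fin N := fun v k => (pos (k, v)).1
  have hidx : ∀ v k, (idx v k : ℕ) = (v + N * k) / p := by
    intro v k
    simp [idx, pos, finProdFinEquiv, Fin.divNat]
  have hgap : ∀ v k k', k < k' → (e (idx v k)).card + p ≤ (e (idx v k')).card := by
    intro v k k' hk
    apply sorted_gap hα e he
    rw [hidx, hidx]
    have h1 : p * n.centralBinom ≤ N / p := by
      rw [Nat.le_div_iff_mul_le hp0, hN]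
      calc _ = p * p * n.centralBinom := by ring
        _ ≤ _ := hn2
    have h2 : (v + N * k : ℕ) / p + N / p ≤ (v + N * k + N) / p := Nat.div_add_div_le_add_div
    have h3 : (v + N * k + N : ℕ) / p ≤ (v + N * k') / p := by
      apply Nat.div_le_div_right
      have : (k : ℕ) + 1 ≤ k' := hk
      have := Nat.mul_le_mul_left N this
      rw [mul_add] at this
      omega
    omega
  have hcopy : ∀ v : Fin N, ∃ φ : P ↪o Finset α, ∀ k, (φ (τ k)).card = (e (idx v k)).card := by
    intro v
    apply exists_copy_levels τ hτ m0 (fun k => (e (idx v k)).card) (hgap v)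
    intro k
    have : (e (idx v k)).card ≤ 2 * n := by rw [← hα]; exact Finset.card_le_univ _
    simp only [m0]
    omega
  choose φ hφ using hcopy
  let a : Fin N × Equiv.Perm α → P ↪o Finset α := fun z =>
    (φ z.1).trans (Finset.mapEmbedding z.2.toEmbedding)
  refine ⟨Finset α, inferInstance, _, isCube_finset α, ULift.{u} (Fin N) × Equiv.Perm α,
    inferInstance, fun z => a (z.1.down, z.2), p * Fintype.card (Equiv.Perm α),
    Nat.mul_pos hp0 Fintype.card_pos, ?_⟩
  intro X
  let c : Finset α → ℕ := fun s =>
    (Finset.univ.filter (fun σ : Equiv.Perm α => s.map σ.toEmbedding = X)).card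
  have hsumc : ∑ s, c s = Fintype.card (Equiv.Perm α) := by
    simp only [c, Finset.card_filter]
    rw [Finset.sum_comm]
    have : ∀ σ : Equiv.Perm α, ∑ s : Finset α, (if s.map σ.toEmbedding = X then 1 else 0) = 1 := by
      intro σ
      rw [← Finset.card_filter, Finset.card_eq_one]
      refine ⟨X.map σ.symm.toEmbedding, ?_⟩
      ext s
      simp only [Finset.mem_filter, Finset.mem_univ, true_and, Finset.mem_singleton]
      constructor
      · rintro rfl
        rw [Finset.map_map]
        ext x; simp
      · rintro rfl
        rw [Finset.map_map]
        ext x; simp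
    rw [Finset.sum_congr rfl (fun σ _ => this σ)]
    simp
  have e1 : {i : ULift.{u} (Fin N) × Equiv.Perm α // X ∈ Set.range (a (i.1.down, i.2))} ≃
      {t : (Fin p × Fin N) × Equiv.Perm α // (φ t.1.2 (τ t.1.1)).map t.2.toEmbedding = X} :=
    { toFun := fun i => ⟨((τ.symm i.2.choose, i.1.1.down), i.1.2), by
          have := i.2.choose_spec
          simp only [Equiv.apply_symm_apply]
          exact this⟩
      invFun := fun t => ⟨(⟨t.1.1.2⟩, t.1.2), ⟨τ t.1.1.1, t.2⟩⟩
      left_inv := by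
        rintro ⟨⟨⟨v⟩, σ⟩, h⟩
        rfl
      right_inv := by
        rintro ⟨⟨⟨k, v⟩, σ⟩, h⟩
        simp only [Subtype.mk.injEq, Prod.mk.injEq, and_true]
        rw [Equiv.symm_apply_eq]
        have hex : X ∈ Set.range (a (v, σ)) := ⟨τ k, h⟩
        exact (a (v, σ)).injective (hex.choose_spec.trans h.symm) }
  rw [Nat.card_congr e1, Nat.card_eq_fintype_card, Fintype.card_subtype, Finset.card_filter,
    Fintype.sum_prod_type]
  have h1 : ∀ kv : Fin p × Fin N, ∑ σ : Equiv.Perm α,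
      (if (φ kv.2 (τ kv.1)).map σ.toEmbedding = X then 1 else 0) = c (e (pos kv).1) := by
    rintro ⟨k, v⟩
    rw [← Finset.card_filter]
    exact card_perm_congr _ _ X (hφ v k)
  rw [Finset.sum_congr rfl (fun kv _ => h1 kv), Equiv.sum_comp pos (fun z => c (e z.1)),
    Fintype.sum_prod_type]
  simp only [Finset.sum_const, Finset.card_univ, Fintype.card_fin, smul_eq_mul]
  rw [← Finset.mul_sum, Equiv.sum_comp e c, hsumc]

end Cover


section Absorb

/-- The block sets used by the absorbers. -/
def rowSet {κ : Type v} (b : Prop) (s : κ → Option (Fin 3)) (E : Set κ) : Set (κ × Fin 3) :=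
  {p | (s p.1 = none ∧ b) ∨ ∃ a, s p.1 = some a ∧ (p.2 = a ∨ (p.2 = a + 1 ∧ p.1 ∈ E))}

theorem mem_rowSet_some {κ : Type v} {b : Prop} {s : κ → Option (Fin 3)} {E : Set κ} {i : κ}
    {a x : Fin 3} (h : s i = some a) :
    (i, x) ∈ rowSet b s E ↔ (x = a ∨ (x = a + 1 ∧ i ∈ E)) := by
  constructor
  · rintro (⟨h1, -⟩ | ⟨c, h1, h2⟩)
    · simp [h] at h1
    · simp only [h, Option.some.injEq] at h1
      subst h1
      exact h2
  · intro h2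
    exact Or.inr ⟨a, h, h2⟩

theorem mem_rowSet_none {κ : Type v} {b : Prop} {s : κ → Option (Fin 3)} {E : Set κ} {i : κ}
    {x : Fin 3} (h : s i = none) : (i, x) ∈ rowSet b s E ↔ b := by
  constructor
  · rintro (⟨-, h1⟩ | ⟨c, h1, -⟩)
    · exact h1
    · simp [h] at h1
  · intro h2
    exact Or.inl ⟨h, h2⟩

theorem fin3_facts (a : Fin 3) : a + 1 ≠ a ∧ a + 2 ≠ a ∧ a + 2 ≠ a + 1 ∧ a + 1 + 1 ≠ a := by
  revert a; decide

theorem rowSet_subset_iff {κ : Type v} {b : Prop} {s : κ → Option (Fin 3)} {E E' : Set κ}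
    (hE : ∀ i ∈ E, s i ≠ none) : rowSet b s E ⊆ rowSet b s E' ↔ E ⊆ E' := by
  constructor
  · intro h i hi
    obtain ⟨a, ha⟩ := Option.ne_none_iff_exists'.1 (hE i hi)
    have h1 : (i, a + 1) ∈ rowSet b s E := (mem_rowSet_some ha).2 (Or.inr ⟨rfl, hi⟩)
    rcases (mem_rowSet_some ha).1 (h h1) with h2 | h2
    · exact absurd h2 (fin3_facts a).1
    · exact h2.2
  · rintro h p (h1 | ⟨a, h1, h2 | h2⟩)
    · exact Or.inl h1
    · exact Or.inr ⟨a, h1, Or.inl h2⟩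
    · exact Or.inr ⟨a, h1, Or.inr ⟨h2.1, h h2.2⟩⟩

theorem rowSet_inj_left {κ : Type v} {b : Prop} {s s' : κ → Option (Fin 3)} {E E' : Set κ}
    (h : rowSet b s E = rowSet b s' E') : s = s' := by
  have key : ∀ (t t' : κ → Option (Fin 3)) (F F' : Set κ), rowSet b t F = rowSet b t' F' →
      ∀ i a, t i = some a → t' i = none → False := by
    intro t t' F F' hh i a h1 h2
    have e : ∀ x, (x = a ∨ (x = a + 1 ∧ i ∈ F)) ↔ b := fun x => by
      rw [← mem_rowSet_some (b := b) h1, hh, mem_rowSet_none h2]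
    have hb : b := (e a).1 (Or.inl rfl)
    rcases (e (a + 2)).2 hb with h3 | h3
    · exact (fin3_facts a).2.1 h3
    · exact (fin3_facts a).2.2.1 h3.1
  funext i
  rcases h1 : s i with _ | a <;> rcases h2 : s' i with _ | a'
  · rfl
  · exact (key s' s E' E h.symm i a' h2 h1).elim
  · exact (key s s' E E' h i a h1 h2).elim
  · have e : ∀ x, (x = a ∨ (x = a + 1 ∧ i ∈ E)) ↔ (x = a' ∨ (x = a' + 1 ∧ i ∈ E')) := fun x => by
      rw [← mem_rowSet_some (b := b) h1, h, mem_rowSet_some h2]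
    rcases (e a).1 (Or.inl rfl) with h3 | ⟨h3, -⟩
    · rw [h3]
    · rcases (e a').2 (Or.inl rfl) with h4 | ⟨h4, -⟩
      · rw [h4]
      · rw [h4] at h3
        exact ((fin3_facts a).2.2.2 h3.symm).elim

theorem exists_good (l : ℕ) (y : Set (Fin (2 * l) × Fin 3)) :
    ∃ s : Fin (2 * l) → Option (Fin 3), l ≤ Nat.card {i // s i ≠ none} ∧
      ((∀ E, rowSet False s E ⊆ y) ∨ (∀ E, y ⊆ rowSet True s E)) := by
  classical
  let hi : Fin (2 * l) → Prop := fun i => ∃ a, (i, a) ∈ y ∧ (i, a + 1) ∈ y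
  have hlo : ∀ i, ¬ hi i → ∃ a, ∀ x, (i, x) ∈ y → x = a := by
    intro i h
    have h' : ∀ a, (i, a) ∈ y → (i, a + 1) ∉ y := fun a h1 h2 => h ⟨a, h1, h2⟩
    by_cases h0 : ∃ a, (i, a) ∈ y
    · obtain ⟨a, ha⟩ := h0
      refine ⟨a, fun x hx => ?_⟩
      have h1 : x ≠ a + 1 := fun e => h' a ha (e ▸ hx)
      have h2 : a ≠ x + 1 := fun e => h' x hx (e ▸ ha)
      revert h1 h2
      clear * -
      revert a x
      decide
    · exact ⟨0, fun x hx => (h0 ⟨x, hx⟩).elim⟩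
  have hcard : Fintype.card {i // hi i} + Fintype.card {i // ¬ hi i} = 2 * l := by
    rw [Fintype.card_subtype_compl]
    have := Fintype.card_subtype_le hi
    simp only [Fintype.card_fin] at *
    omega
  rcases le_total l (Fintype.card {i // hi i}) with h | h
  · refine ⟨fun i => if h : hi i then some h.choose else none, ?_, Or.inl ?_⟩
    · have : ∀ i, ((if h : hi i then some h.choose else none : Option (Fin 3)) ≠ none) ↔ hi i := by
        intro i
        by_cases h1 : hi i <;> simp [h1]
      rw [Nat.card_congr (Equiv.subtypeEquivRight this), Nat.card_eq_fintype_card]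
      exact h
    · rintro E ⟨i, x⟩ hx
      by_cases h1 : hi i
      · rw [mem_rowSet_some (a := h1.choose) (by simp [h1])] at hx
        have := h1.choose_spec
        rcases hx with rfl | ⟨rfl, -⟩
        · exact this.1
        · exact this.2
      · rw [mem_rowSet_none (by simp [h1])] at hx
        exact hx.elim
  · refine ⟨fun i => if h : hi i then none else some (hlo i h).choose, ?_, Or.inr ?_⟩
    · have : ∀ i, ((if h : hi i then none else some (hlo i h).choose : Option (Fin 3)) ≠ none)
          ↔ ¬ hi i := by
        intro i
        by_cases h1 : hi i <;> simp [h1]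
      rw [Nat.card_congr (Equiv.subtypeEquivRight this), Nat.card_eq_fintype_card]
      omega
    · rintro E ⟨i, x⟩ hx
      by_cases h1 : hi i
      · rw [mem_rowSet_none (by simp [h1])]
        trivial
      · rw [mem_rowSet_some (a := (hlo i h1).choose) (by simp [h1])]
        exact Or.inl ((hlo i h1).choose_spec x hx)

theorem absorb_abstract {P : Type u} [PartialOrder P] [BoundedOrder P] {Y : Type v}
    [PartialOrder Y] {J : Type w} (ty : J → Bool) (Φ : (J × P) ⊕ {q : P // q ≠ ⊤} → Y)
    (hinj : Function.Injective Φ)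
    (hg : ∀ j q q', Φ (Sum.inl (j, q)) ≤ Φ (Sum.inl (j, q')) ↔ q ≤ q')
    (hh : ∀ q q', Φ (Sum.inr q) ≤ Φ (Sum.inr q') ↔ q ≤ q')
    (hh' : ∀ j q, Φ (Sum.inr q) ≤ Φ (Sum.inl (j, bif ty j then ⊤ else ⊥)))
    (y : Y) (hy : y ∉ Set.range Φ)
    (hgood : ∃ j, (ty j = true ∧ ∀ q, q ≠ ⊤ → Φ (Sum.inl (j, q)) ≤ y) ∨
      (ty j = false ∧ ∀ q, q ≠ ⊥ → y ≤ Φ (Sum.inl (j, q)))) :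
    PartitionedIntoCopies P (insert y (Set.range Φ)) := by
  classical
  obtain ⟨j, hj⟩ := hgood
  set sp : P := bif ty j then ⊤ else ⊥ with hsp
  have hne : ∀ x, Φ x ≠ y := fun x h => hy ⟨x, h⟩
  have t1 : PartitionedIntoCopies P (insert y ((fun q => Φ (Sum.inl (j, q))) '' {q | q ≠ sp})) := by
    rcases hj with ⟨h1, h2⟩ | ⟨h1, h2⟩
    · have : sp = ⊤ := by simp [hsp, h1]
      rw [this]
      exact tiled_topswap _ (fun q q' _ _ => hg j q q') y
        (fun q hq => lt_of_le_of_ne (h2 q hq) (hne _))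
    · have : sp = ⊥ := by simp [hsp, h1]
      rw [this]
      exact tiled_botswap _ (fun q q' _ _ => hg j q q') y
        (fun q hq => lt_of_le_of_ne (h2 q hq) (hne _).symm)
  have t2 : PartitionedIntoCopies P (⋃ i : {i // i ≠ j}, Set.range (fun q => Φ (Sum.inl (i.1, q)))) := by
    apply tiled_iUnion
    · intro i
      exact tiled_range (OrderEmbedding.ofMapLEIff (fun q => Φ (Sum.inl (i.1, q))) (hg i.1))
    · intro i i' hii
      rw [Function.onFun, Set.disjoint_left]
      rintro _ ⟨q, rfl⟩ ⟨q', h⟩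
      have := hinj h
      simp only [Sum.inl.injEq, Prod.mk.injEq] at this
      exact hii (Subtype.ext this.1.symm)
  have t3 : PartitionedIntoCopies P (insert (Φ (Sum.inl (j, sp)))
      (Set.range (fun q => Φ (Sum.inr q)))) := by
    have := tiled_topswap (P := P) (fun q => if h : q = ⊤ then y else Φ (Sum.inr ⟨q, h⟩))
      (by
        intro q q' h h'
        simp only [h, h', dif_neg, not_false_eq_true]
        exact hh _ _) (Φ (Sum.inl (j, sp)))
      (by
        intro q h
        simp only [h, dif_neg, not_false_eq_true]
        exact lt_of_le_of_ne (hh' j _) (fun e => by simpa using hinj e))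
    convert this using 2
    ext z
    constructor
    · rintro ⟨q, rfl⟩
      exact ⟨q.1, q.2, by simp [q.2]⟩
    · rintro ⟨q, hq, rfl⟩
      have hq : q ≠ ⊤ := hq
      exact ⟨⟨q, hq⟩, by simp [hq]⟩
  have := tiled_union (tiled_union t1 t2 ?_) t3 ?_
  · convert this using 1
    ext z
    constructor
    · rintro (rfl | ⟨⟨i, q⟩ | q, rfl⟩)
      · exact Or.inl (Or.inl (Or.inl rfl))
      · by_cases hi : i = j
        · subst hi
          by_cases hq : q = sp
          · subst hq
            exact Or.inr (Or.inl rfl)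
          · exact Or.inl (Or.inl (Or.inr ⟨q, hq, rfl⟩))
        · exact Or.inl (Or.inr (Set.mem_iUnion.2 ⟨⟨i, hi⟩, q, rfl⟩))
      · exact Or.inr (Or.inr ⟨q, rfl⟩)
    · rintro (((rfl | ⟨q, _, rfl⟩) | h) | h)
      · exact Or.inl rfl
      · exact Or.inr ⟨_, rfl⟩
      · obtain ⟨i, q, rfl⟩ := Set.mem_iUnion.1 h
        exact Or.inr ⟨_, rfl⟩
      · rcases h with rfl | ⟨q, rfl⟩
        · exact Or.inr ⟨_, rfl⟩
        · exact Or.inr ⟨_, rfl⟩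
  · rw [Set.disjoint_left]
    rintro z hz h
    obtain ⟨i, q, rfl⟩ := Set.mem_iUnion.1 h
    rcases hz with h1 | ⟨q', _, h1⟩
    · exact hne _ h1
    · have := hinj h1
      simp only [Sum.inl.injEq, Prod.mk.injEq] at this
      exact i.2 this.1.symm
  · rw [Set.disjoint_left]
    rintro z hz h
    rcases hz with (rfl | ⟨q, hq, rfl⟩) | hz
    · rcases h with h | ⟨q, h⟩
      · exact hne _ h.symm
      · exact hne _ h
    · rcases h with h | ⟨q', h⟩
      · have := hinj h
        simp only [Sum.inl.injEq, Prod.mk.injEq] at this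
        exact hq this.2
      · simpa using hinj h
    · obtain ⟨i, q, rfl⟩ := Set.mem_iUnion.1 hz
      rcases h with h | ⟨q', h⟩
      · have := hinj h
        simp only [Sum.inl.injEq, Prod.mk.injEq] at this
        exact i.2 this.1
      · simpa using hinj h

end Absorb


section Absorber

theorem absorb_many {P : Type u} [PartialOrder P] {Y : Type v} [PartialOrder Y] {I : Type w}
    {nu : ℕ} (Φ : Fin nu → I → Y) (hinj : ∀ κ κ' i i', Φ κ i = Φ κ' i' → κ = κ' ∧ i = i')
    (h : ∀ κ y, y ∉ Set.range (Function.uncurry Φ) →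
      PartitionedIntoCopies P (insert y (Set.range (Φ κ))))
    (W : Finset Y) (hd : Disjoint (W : Set Y) (Set.range (Function.uncurry Φ)))
    (hW : W.card = nu) :
    PartitionedIntoCopies P ((W : Set Y) ∪ Set.range (Function.uncurry Φ)) := by
  classical
  subst hW
  let e := W.equivFin.symm
  have hnot : ∀ κ, (e κ).1 ∉ Set.range (Function.uncurry Φ) := fun κ =>
    Set.disjoint_left.1 hd (e κ).2
  have := tiled_iUnion (P := P) (fun κ => insert (e κ).1 (Set.range (Φ κ)))
    (fun κ => h κ _ (hnot κ)) ?_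
  · convert this using 1
    ext z
    constructor
    · rintro (hz | ⟨⟨κ, i⟩, rfl⟩)
      · exact Set.mem_iUnion.2 ⟨e.symm ⟨z, hz⟩, Or.inl (by simp)⟩
      · exact Set.mem_iUnion.2 ⟨κ, Or.inr ⟨i, rfl⟩⟩
    · intro hz
      obtain ⟨κ, rfl | ⟨i, rfl⟩⟩ := Set.mem_iUnion.1 hz
      · exact Or.inl (e κ).2
      · exact Or.inr ⟨(κ, i), rfl⟩
  · intro κ κ' hne
    rw [Function.onFun, Set.disjoint_left]
    rintro z (rfl | ⟨i, rfl⟩) (h1 | ⟨i', h1⟩)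
    · exact hne (e.injective (Subtype.ext h1))
    · exact hnot κ ⟨(κ', i'), h1⟩
    · exact hnot κ' ⟨(κ, i), h1⟩
    · exact hne (hinj _ _ _ _ h1).1.symm

theorem exists_absorber (P : Type u) [PartialOrder P] [Fintype P] [BoundedOrder P] (nu : ℕ) :
    ∃ (Y0 : Type u) (_ : PartialOrder Y0) (d0 : ℕ) (_ : IsCube Y0 d0) (c : ℕ),
      ∀ (Z : Type) [PartialOrder Z] [BoundedOrder Z], (⊥ : Z) ≠ ⊤ →
        ∃ R : Set (Y0 × Z), R.ncard = nu * c ∧ (∀ p ∈ R, p.2 = ⊥ ∨ p.2 = ⊤) ∧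
          ∀ W : Finset (Y0 × Z), Disjoint (W : Set (Y0 × Z)) R → W.card = nu →
            PartitionedIntoCopies P ((W : Set (Y0 × Z)) ∪ R) := by
  classical
  let l := Fintype.card P + nu
  let Sig := {s : Fin (2 * l) → Option (Fin 3) // l ≤ Nat.card {i // s i ≠ none}}
  let J := Bool × Sig
  have hε : ∀ s : Sig, ∃ ε : P ⊕ Fin nu → Fin (2 * l), Function.Injective ε ∧
      ∀ z, s.1 (ε z) ≠ none := by
    intro s
    have h := s.2
    rw [Nat.card_eq_fintype_card] at h
    have h' : Fintype.card (P ⊕ Fin nu) ≤ Fintype.card {i // s.1 i ≠ none} := by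
      simpa [l] using h
    obtain ⟨f⟩ := Function.Embedding.nonempty_of_card_le h'
    exact ⟨fun z => (f z).1, fun a b h => f.injective (Subtype.ext h), fun z => (f z).2⟩
  choose ε hεi hεs using hε
  let H : P → Fin nu → Set (P ⊕ Fin nu) := fun q κ =>
    {z | (∃ q', q' ≤ q ∧ z = Sum.inl q') ∨ z = Sum.inr κ}
  have hHle : ∀ q q' κ κ', H q κ ⊆ H q' κ' ↔ q ≤ q' ∧ κ = κ' := by
    intro q q' κ κ'
    constructor
    · intro h
      constructor
      · rcases h (a := Sum.inl q) (Or.inl ⟨q, le_rfl, rfl⟩) with ⟨q'', h1, h2⟩ | h1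
        · cases h2
          exact h1
        · cases h1
      · rcases h (a := Sum.inr κ) (Or.inr rfl) with ⟨q'', h1, h2⟩ | h1
        · cases h2
        · cases h1
          rfl
    · rintro ⟨h1, rfl⟩ z (⟨q'', h2, rfl⟩ | rfl)
      · exact Or.inl ⟨q'', h2.trans h1, rfl⟩
      · exact Or.inr rfl
  have hHinj : ∀ q q' κ κ', H q κ = H q' κ' → q = q' ∧ κ = κ' := by
    intro q q' κ κ' h
    have h1 := (hHle q q' κ κ').1 h.le
    have h2 := (hHle q' q κ' κ).1 h.ge
    exact ⟨le_antisymm h1.1 h2.1, h1.2⟩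
  have hHne : ∀ q κ, H q κ ≠ ∅ := fun q κ h => by
    have : Sum.inr κ ∈ H q κ := Or.inr rfl
    rw [h] at this
    exact this
  let T : Prop → Sig → P → Fin nu → Set (Fin (2 * l) × Fin 3) := fun b s q κ =>
    rowSet b s.1 (ε s '' H q κ)
  have hTle : ∀ b s q q' κ κ', T b s q κ ⊆ T b s q' κ' ↔ q ≤ q' ∧ κ = κ' := by
    intro b s q q' κ κ'
    rw [← hHle]
    simp only [T]
    rw [rowSet_subset_iff, Set.image_subset_image_iff (hεi s)]
    rintro _ ⟨z, _, rfl⟩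
    exact hεs s z
  have hTinj : ∀ b s s' q q' κ κ', T b s q κ = T b s' q' κ' → s = s' ∧ q = q' ∧ κ = κ' := by
    intro b s s' q q' κ κ' h
    have hs : s = s' := Subtype.ext (rowSet_inj_left h)
    subst hs
    have h1 := (hTle b s q q' κ κ').1 h.le
    have h2 := (hTle b s q' q κ' κ).1 h.ge
    exact ⟨rfl, le_antisymm h1.1 h2.1, h1.2⟩
  obtain ⟨d0, hd0⟩ : ∃ d0, IsCube (Set (Fin (2 * l) × Fin 3) × Set (P ⊕ Fin nu) ×
      Set (J × Fin nu)) d0 := ⟨_, (isCube_set _).prod ((isCube_set _).prod (isCube_set _))⟩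
  refine ⟨Set (Fin (2 * l) × Fin 3) × Set (P ⊕ Fin nu) × Set (J × Fin nu), inferInstance, d0, hd0,
    Nat.card ((J × P) ⊕ {q : P // q ≠ ⊤}), ?_⟩
  intro Z _ _ hZ
  let Φ : Fin nu → ((J × P) ⊕ {q : P // q ≠ ⊤}) →
      (Set (Fin (2 * l) × Fin 3) × Set (P ⊕ Fin nu) × Set (J × Fin nu)) × Z := fun κ x =>
    match x with
    | Sum.inl ((true, s), q) => if q = ⊤ then ((Set.univ, Set.univ, {((true, s), κ)}), ⊥)
        else ((T False s q κ, ∅, ∅), ⊥)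
    | Sum.inl ((false, s), q) => if q = ⊥ then ((∅, Set.univ, {((false, s), κ)}), ⊥)
        else ((T True s q κ, Set.univ, Set.univ), ⊤)
    | Sum.inr q => ((∅, H q.1 κ, ∅), ⊥)
  have e1 : ∀ κ s, Φ κ (Sum.inl ((true, s), ⊤)) = ((Set.univ, Set.univ, {((true, s), κ)}), ⊥) :=
    fun κ s => if_pos rfl
  have e2 : ∀ κ s q, q ≠ ⊤ → Φ κ (Sum.inl ((true, s), q)) = ((T False s q κ, ∅, ∅), ⊥) :=
    fun κ s q h => if_neg h
  have e3 : ∀ κ s, Φ κ (Sum.inl ((false, s), ⊥)) = ((∅, Set.univ, {((false, s), κ)}), ⊥) :=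
    fun κ s => if_pos rfl
  have e4 : ∀ κ s q, q ≠ ⊥ → Φ κ (Sum.inl ((false, s), q)) =
      ((T True s q κ, Set.univ, Set.univ), ⊤) :=
    fun κ s q h => if_neg h
  have e5 : ∀ κ q, Φ κ (Sum.inr q) = ((∅, H q.1 κ, ∅), ⊥) := fun κ q => rfl
  clear_value Φ
  -- shapes
  have hcases : ∀ x : (J × P) ⊕ {q : P // q ≠ ⊤},
      (∃ s, x = Sum.inl ((true, s), ⊤)) ∨ (∃ s q, q ≠ ⊤ ∧ x = Sum.inl ((true, s), q)) ∨
      (∃ s, x = Sum.inl ((false, s), ⊥)) ∨ (∃ s q, q ≠ ⊥ ∧ x = Sum.inl ((false, s), q)) ∨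
      (∃ q, x = Sum.inr q) := by
    rintro (⟨⟨(_ | _), s⟩, q⟩ | q)
    · by_cases hq : q = ⊥
      · subst hq
        exact Or.inr (Or.inr (Or.inl ⟨s, rfl⟩))
      · exact Or.inr (Or.inr (Or.inr (Or.inl ⟨s, q, hq, rfl⟩)))
    · by_cases hq : q = ⊤
      · subst hq
        exact Or.inl ⟨s, rfl⟩
      · exact Or.inr (Or.inl ⟨s, q, hq, rfl⟩)
    · exact Or.inr (Or.inr (Or.inr (Or.inr ⟨q, rfl⟩)))
  have nes : ∀ a : J × Fin nu, (∅ : Set (J × Fin nu)) ≠ {a} := fun a =>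
    (Set.singleton_ne_empty a).symm
  have neU : (∅ : Set (P ⊕ Fin nu)) ≠ Set.univ := by
    intro h
    have : Sum.inl (⊥ : P) ∈ (∅ : Set (P ⊕ Fin nu)) := h ▸ Set.mem_univ _
    exact this
  have hinj : ∀ κ κ' i i', Φ κ i = Φ κ' i' → κ = κ' ∧ i = i' := by
    intro κ κ' i i' h
    rcases hcases i with ⟨s, rfl⟩ | ⟨s, q, hq, rfl⟩ | ⟨s, rfl⟩ | ⟨s, q, hq, rfl⟩ | ⟨q, rfl⟩ <;>
    rcases hcases i' with ⟨s', rfl⟩ | ⟨s', q', hq', rfl⟩ | ⟨s', rfl⟩ | ⟨s', q', hq', rfl⟩ | ⟨q', rfl⟩ <;>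
    simp (discharger := assumption) only [e1, e2, e3, e4, e5, Prod.mk.injEq, hZ, hZ.symm, neU,
      neU.symm, Set.singleton_ne_empty, nes, hHne, (hHne _ _).symm, and_false, false_and,
      and_true, true_and, Set.singleton_eq_singleton_iff, reduceCtorEq] at h
    · obtain ⟨rfl, rfl⟩ := h
      exact ⟨rfl, rfl⟩
    · obtain ⟨rfl, rfl, rfl⟩ := hTinj _ _ _ _ _ _ _ h
      exact ⟨rfl, rfl⟩
    · obtain ⟨rfl, rfl⟩ := h
      exact ⟨rfl, rfl⟩
    · obtain ⟨rfl, rfl, rfl⟩ := hTinj _ _ _ _ _ _ _ h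
      exact ⟨rfl, rfl⟩
    · obtain ⟨h1, rfl⟩ := hHinj _ _ _ _ h
      exact ⟨rfl, by rw [Subtype.ext h1]⟩
  have hrange : ∀ κ y, y ∉ Set.range (Function.uncurry Φ) → y ∉ Set.range (Φ κ) := by
    rintro κ y hy ⟨i, rfl⟩
    exact hy ⟨(κ, i), rfl⟩
  refine ⟨Set.range (Function.uncurry Φ), ?_, ?_, absorb_many Φ hinj ?_⟩
  · have hinj' : Function.Injective (Function.uncurry Φ) := by
      rintro ⟨κ, i⟩ ⟨κ', i'⟩ h
      obtain ⟨rfl, rfl⟩ := hinj κ κ' i i' h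
      rfl
    rw [← Set.image_univ, Set.ncard_image_of_injective _ hinj', Set.ncard_univ, Nat.card_prod,
      Nat.card_eq_fintype_card, Fintype.card_fin]
  · rintro _ ⟨⟨κ, i⟩, rfl⟩
    rw [Function.uncurry_apply_pair]
    rcases hcases i with ⟨s, rfl⟩ | ⟨s, q, hq, rfl⟩ | ⟨s, rfl⟩ | ⟨s, q, hq, rfl⟩ | ⟨q, rfl⟩
    · rw [e1]; exact Or.inl rfl
    · rw [e2 _ _ _ hq]; exact Or.inl rfl
    · rw [e3]; exact Or.inl rfl
    · rw [e4 _ _ _ hq]; exact Or.inr rfl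
    · rw [e5]; exact Or.inl rfl
  · intro κ y hy
    refine absorb_abstract (fun j : J => j.1) (Φ κ) (fun i i' h => (hinj _ _ _ _ h).2) ?_ ?_ ?_ y
      (hrange κ y hy) ?_
    · rintro ⟨(_ | _), s⟩ q q'
      · by_cases hq : q = ⊥ <;> by_cases hq' : q' = ⊥
        · subst hq hq'; simp
        · subst hq; rw [e3, e4 _ _ _ hq']; simp
        · subst hq'; rw [e3, e4 _ _ _ hq]; simp [hq, hZ.symm]
        · rw [e4 _ _ _ hq, e4 _ _ _ hq']
          simp [hTle]
      · by_cases hq : q = ⊤ <;> by_cases hq' : q' = ⊤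
        · subst hq hq'; simp
        · subst hq; rw [e1, e2 _ _ _ hq']; simp [hq']
        · subst hq'; rw [e1, e2 _ _ _ hq]; simp
        · rw [e2 _ _ _ hq, e2 _ _ _ hq']
          simp [hTle]
    · intro q q'
      rw [e5, e5]
      simp [hHle]
    · rintro ⟨(_ | _), s⟩ q
      · simp only [cond_false]; rw [e3, e5]; simp
      · simp only [cond_true]; rw [e1, e5]; simp
    · obtain ⟨s, hs, h | h⟩ := exists_good l y.1.1
      · refine ⟨(true, ⟨s, hs⟩), Or.inl ⟨rfl, fun q hq => ?_⟩⟩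
        rw [e2 _ _ _ hq]
        exact ⟨⟨h _, Set.empty_subset _, Set.empty_subset _⟩, bot_le⟩
      · refine ⟨(false, ⟨s, hs⟩), Or.inr ⟨rfl, fun q hq => ?_⟩⟩
        rw [e4 _ _ _ hq]
        exact ⟨⟨h _, Set.subset_univ _, Set.subset_univ _⟩, le_top⟩

end Absorber


section Assembly

theorem exists_two_pow (r Bd : ℕ) (hr : 0 < r) :
    ∃ x d, r ∣ 2 ^ (x + d + 2) - 2 ^ x ∧ Bd ≤ 2 ^ (x + d + 2) - 2 ^ x := by
  obtain ⟨v, hv⟩ := Finite.exists_infinite_fiber (fun n : ℕ => (⟨2 ^ n % r, Nat.mod_lt _ hr⟩ : Fin r))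
  have hinf := Set.infinite_coe_iff.1 hv
  obtain ⟨x, hx⟩ := hinf.nonempty
  obtain ⟨y, hy, hxy⟩ := hinf.exists_gt (x + Bd + 2)
  obtain ⟨d, rfl⟩ : ∃ d, y = x + d + 2 := ⟨y - x - 2, by omega⟩
  have hmod : 2 ^ x ≡ 2 ^ (x + d + 2) [MOD r] := by
    have h : (⟨2 ^ x % r, Nat.mod_lt _ hr⟩ : Fin r) = ⟨2 ^ (x + d + 2) % r, Nat.mod_lt _ hr⟩ :=
      (show _ = v from hx).trans (show _ = v from hy).symm
    exact congrArg Fin.val h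
  have hle : 2 ^ x ≤ 2 ^ (x + d + 2) := Nat.pow_le_pow_right (by norm_num) (by omega)
  refine ⟨x, d, (Nat.modEq_iff_dvd' hle).1 hmod, ?_⟩
  have h1 : 2 ^ (x + d + 2) = 2 ^ x * (2 ^ d * 4) := by ring
  have h2 : d < 2 ^ d := Nat.lt_two_pow_self
  have h3 : 1 ≤ 2 ^ x := Nat.one_le_two_pow
  have h4 : 2 ^ x * (2 ^ d * 4) = 2 ^ x * (2 ^ d * 4 - 1) + 2 ^ x := by
    rw [← Nat.mul_succ]
    congr 1
    omega
  rw [h1, h4, Nat.add_sub_cancel]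
  calc Bd ≤ 1 * (2 ^ d * 4 - 1) := by omega
    _ ≤ _ := Nat.mul_le_mul_right _ h3

theorem IsCube.finite {Q : Type v} [PartialOrder Q] {n : ℕ} (h : IsCube Q n) : Finite Q := by
  obtain ⟨e⟩ := h
  exact Finite.of_equiv _ e.symm.toEquiv

theorem IsCube.card {Q : Type v} [PartialOrder Q] {n : ℕ} (h : IsCube Q n) :
    Nat.card Q = 2 ^ n := by
  obtain ⟨e⟩ := h
  rw [Nat.card_congr e.toEquiv, Nat.card_eq_fintype_card]
  simp

theorem isCube_set_fin (n : ℕ) : IsCube (Set (Fin n)) n := ⟨OrderIso.refl _⟩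

theorem main_cube (P : Type u) [PartialOrder P] [Fintype P] [BoundedOrder P] :
    ∃ (M b : ℕ) (_ : b < M) (f : Set (Fin b) ↪o Set (Fin M)),
      PartitionedIntoCopies P (Set.range f)ᶜ := by
  classical
  obtain ⟨X, _, m, hX, ι, _, a, r, hr, ha⟩ := exists_uniform_cover P
  obtain ⟨nu, hnu⟩ : ∃ nu, nu = r * Fintype.card ι := ⟨_, rfl⟩
  obtain ⟨Y0, _, d0, hY0, c, habs⟩ := exists_absorber P nu
  obtain ⟨x, d, hdvd, hBd⟩ := exists_two_pow r (nu * c + nu) hr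
  obtain ⟨R, hRc, hRZ, hR⟩ := habs (Set (Fin (d + 2)) × Set (Fin x)) (by
    intro h
    have h1 : (⊥ : Set (Fin (d + 2))) = ⊤ := congrArg Prod.fst h
    have h2 : (0 : Fin (d + 2)) ∈ (⊥ : Set (Fin (d + 2))) := h1 ▸ Set.mem_univ _
    exact h2)
  have hY := hY0.prod ((isCube_set_fin (d + 2)).prod (isCube_set_fin x))
  have := hY.finite
  have := hY0.finite
  let W0 : Set (Y0 × (Set (Fin (d + 2)) × Set (Fin x))) := {p | p.2.1 = {0}}
  have hW0R : Disjoint R W0 := by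
    rw [Set.disjoint_left]
    intro p hp hp'
    have hp' : p.2.1 = {0} := hp'
    rcases hRZ p hp with h | h
    · rw [h] at hp'
      exact (Set.singleton_ne_empty _) hp'.symm
    · rw [h] at hp'
      have : (1 : Fin (d + 2)) ∈ ({0} : Set (Fin (d + 2))) := hp' ▸ Set.mem_univ _
      exact (by simp at this)
  have hW0c : W0.ncard = 2 ^ d0 * 2 ^ x := by
    have : W0 = Set.range (fun p : Y0 × Set (Fin x) => (p.1, (({0} : Set (Fin (d + 2))), p.2))) := by
      ext ⟨p, q, s⟩
      constructor
      · intro h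
        have h : q = {0} := h
        exact ⟨(p, s), by simp [h]⟩
      · rintro ⟨t, h⟩
        simp only [Prod.mk.injEq] at h
        exact h.2.1.symm
    rw [this, ← Set.image_univ, Set.ncard_image_of_injective, Set.ncard_univ, Nat.card_prod,
      hY0.card, (isCube_set_fin x).card]
    rintro ⟨p, s⟩ ⟨p', s'⟩ h
    simp only [Prod.mk.injEq, true_and] at h
    exact Prod.ext h.1 h.2
  have hfin : ((R ∪ W0)ᶜ).Finite := Set.toFinite _
  have hcard : ∃ j, hfin.toFinset.card = nu + r * j := by
    have h1 := Set.ncard_add_ncard_compl (R ∪ W0)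
    rw [Set.ncard_union_eq hW0R, hRc, hW0c, hY.card, Set.ncard_eq_toFinset_card _ hfin] at h1
    obtain ⟨t, ht⟩ := hdvd
    have hle : 2 ^ x ≤ 2 ^ (x + d + 2) := Nat.pow_le_pow_right (by norm_num) (by omega)
    have h2 : 2 ^ (d0 + (d + 2 + x)) = 2 ^ d0 * (r * t) + 2 ^ d0 * 2 ^ x := by
      rw [← ht, ← Nat.mul_add, Nat.sub_add_cancel hle]
      ring
    have h3 : 1 * (nu * c + nu) ≤ 2 ^ d0 * (r * t) := by
      rw [← ht]
      exact Nat.mul_le_mul Nat.one_le_two_pow hBd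
    have h4 : hfin.toFinset.card + nu * c = 2 ^ d0 * (r * t) := by omega
    refine ⟨2 ^ d0 * t - (Fintype.card ι * c + Fintype.card ι), ?_⟩
    rw [Nat.mul_sub]
    have h5 : r * (2 ^ d0 * t) = 2 ^ d0 * (r * t) := by ring
    have h6 : r * (Fintype.card ι * c + Fintype.card ι) = nu * c + nu := by rw [hnu]; ring
    rw [h5, h6]
    omega
  obtain ⟨j, hj⟩ := hcard
  have hn : Fintype.card ι ≤ nu + r := by
    rw [hnu]
    nlinarith
  obtain ⟨Q, _, b, hQ, hT⟩ := fiber_lemma hX a r ha R nu hn hR j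
  have hT' := hT hfin.toFinset (by
    rw [Set.Finite.coe_toFinset, Set.disjoint_left]
    intro z hz hz'
    exact hz (Or.inl hz')) hj
  obtain ⟨e1⟩ := hQ.prod (hY0.prod (isCube_set_fin x))
  obtain ⟨e2⟩ := hQ.prod hY
  let f : Q × (Y0 × Set (Fin x)) ↪o Q × (Y0 × (Set (Fin (d + 2)) × Set (Fin x))) :=
    OrderEmbedding.ofMapLEIff (fun t => (t.1, (t.2.1, (({0} : Set (Fin (d + 2))), t.2.2))))
      (by
        intro t t'
        simp [Prod.le_def])
  refine ⟨_, _, ?_, e1.symm.toOrderEmbedding.trans (f.trans e2.toOrderEmbedding), ?_⟩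
  · omega
  · have hT2 := tiled_image (P := P) e2.toOrderEmbedding hT'
    convert hT2 using 1
    ext z
    obtain ⟨⟨q, p, s, w⟩, rfl⟩ := e2.surjective z
    have l1 : e2 (q, p, s, w) ∈ Set.range (e1.symm.toOrderEmbedding.trans
        (f.trans e2.toOrderEmbedding)) ↔ s = {0} := by
      constructor
      · rintro ⟨t, ht⟩
        have : f (e1.symm t) = (q, p, s, w) := e2.injective ht
        exact (congrArg (fun t => t.2.2.1) this).symm
      · rintro rfl
        refine ⟨e1 (q, p, w), ?_⟩
        change e2 (f (e1.symm (e1 (q, p, w)))) = _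
        rw [OrderIso.symm_apply_apply]
        rfl
    have l2 : e2 (q, p, s, w) ∈ e2.toOrderEmbedding '' (Set.univ ×ˢ ((hfin.toFinset : Set _) ∪ R)) ↔
        (p, s, w) ∈ (hfin.toFinset : Set _) ∪ R := by
      constructor
      · rintro ⟨t, ht, h⟩
        have : t = (q, p, s, w) := e2.injective h
        subst this
        exact ht.2
      · intro h
        exact ⟨_, ⟨Set.mem_univ _, h⟩, rfl⟩
    rw [l2, Set.mem_compl_iff, l1, Set.Finite.coe_toFinset]
    constructor
    · intro h
      by_cases h' : (p, s, w) ∈ R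
      · exact Or.inr h'
      · refine Or.inl ?_
        rintro (h2 | h2)
        · exact h' h2
        · exact h h2
    · rintro (h | h) hs
      · exact h (Or.inr hs)
      · exact Set.disjoint_left.1 hW0R h hs

theorem main_bounded (P : Type u) [PartialOrder P] [Fintype P] [BoundedOrder P] :
    ∃ c : ℕ, ∀ n : ℕ,
      ∃ S : Finset (Finset (Fin n)), S.card ≤ c ∧
        PartitionedIntoCopies P ((↑S : Set (Finset (Fin n)))ᶜ) := by
  classical
  obtain ⟨M, b, hbM, f, hf⟩ := main_cube P
  refine ⟨2 ^ M, fun n => ?_⟩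
  obtain ⟨S, hS, hT⟩ := induct_cube hbM f hf n
  let e : Set (Fin n) ≃o Finset (Fin n) := (Fintype.finsetOrderIsoSet (α := Fin n)).symm
  have hfin : (e '' S).Finite := Set.toFinite _
  refine ⟨hfin.toFinset, ?_, ?_⟩
  · rw [← Set.ncard_eq_toFinset_card _ hfin, Set.ncard_image_of_injective _ e.injective]
    exact hS
  · have := tiled_image (P := P) e.toOrderEmbedding hT
    convert this using 1
    rw [Set.Finite.coe_toFinset]
    exact (Set.image_compl_eq e.bijective).symm

end Assembly



/-- **Theorem A.** If a finite poset `P` has a unique maximal and a unique minimal element,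
then there is a constant `c = c(P)` such that for every positive integer `n`, all but at most
`c` elements of the Boolean lattice `2^[n]` (modelled as `Finset (Fin n)` ordered by
inclusion) can be partitioned into copies of `P`. -/
theorem boolean_lattice_almost_partition (P : Type*) [PartialOrder P] [Fintype P]
    (hmax : ∃! x : P, IsMax x) (hmin : ∃! x : P, IsMin x) :
    ∃ c : ℕ, ∀ n : ℕ, 0 < n →
      ∃ S : Finset (Finset (Fin n)), S.card ≤ c ∧
        PartitionedIntoCopies P ((↑S : Set (Finset (Fin n)))ᶜ) := by
  obtain ⟨t, ht, htu⟩ := hmax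
  obtain ⟨o, ho, hou⟩ := hmin
  have htop : ∀ x : P, x ≤ t := by
    intro x
    obtain ⟨z, hxz, hz⟩ := (Set.toFinite (Set.univ : Set P)).exists_le_maximal (Set.mem_univ x)
    have hz' : IsMax z := fun w hw => hz.2 (Set.mem_univ w) hw
    rw [htu z hz'] at hxz
    exact hxz
  have hbot : ∀ x : P, o ≤ x := by
    intro x
    obtain ⟨z, hxz, hz⟩ := (Set.toFinite (Set.univ : Set P)).exists_le_minimal (Set.mem_univ x)
    have hz' : IsMin z := fun w hw => hz.2 (Set.mem_univ w) hw
    rw [hou z hz'] at hxz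
    exact hxz
  let : BoundedOrder P := { top := t, le_top := htop, bot := o, bot_le := hbot }
  obtain ⟨c, hc⟩ := main_bounded P
  exact ⟨c, fun n _ => hc n⟩
end

section
/- Let P be a finite poset with a unique maximal element and a unique minimal element. Then for all sufficiently large positive integers d, the d-dimensional grid [2|P|]^d can be partitioned into copies of P. -/
/-! Basic facts on partitions into copies. -/

namespace GridPart

open Function

lemma isCopy_range {P Q : Type*} [PartialOrder P] [PartialOrder Q] (f : P ↪o Q) :
    IsCopy P (Set.range f) := ⟨f.orderIso⟩

lemma isCopy_exists_emb {P Q : Type*} [PartialOrder P] [PartialOrder Q] {A : Set Q}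
    (h : IsCopy P A) : ∃ f : P ↪o Q, Set.range f = A := by
  obtain ⟨e⟩ := h
  refine ⟨e.toOrderEmbedding.trans (OrderEmbedding.subtype _), ?_⟩
  ext x
  constructor
  · rintro ⟨p, rfl⟩
    exact (e p).2
  · intro hx
    exact ⟨e.symm ⟨x, hx⟩, by simp⟩

/-- Image of a copy under an order embedding. -/
lemma isCopy_image {P Q Q' : Type*} [PartialOrder P] [PartialOrder Q] [PartialOrder Q']
    {A : Set Q} (h : IsCopy P A) (g : Q ↪o Q') : IsCopy P (g '' A) := by
  obtain ⟨f, rfl⟩ := isCopy_exists_emb h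
  have := isCopy_range (f.trans g)
  convert this using 1
  rw [← Set.range_comp]; rfl

/-- Partition described by the function sending a point to its tile. -/
lemma good_of_fun {P Q : Type*} [PartialOrder P] [PartialOrder Q] {S : Set Q}
    (C : Q → Set Q) (h1 : ∀ z ∈ S, IsCopy P (C z)) (h2 : ∀ z ∈ S, z ∈ C z)
    (h3 : ∀ z ∈ S, C z ⊆ S) (h4 : ∀ z ∈ S, ∀ w ∈ C z, C w = C z) :
    PartitionedIntoCopies P S := by
  refine ⟨C '' S, ?_, ?_, ?_⟩
  · rintro _ ⟨z, hz, rfl⟩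
    exact h1 z hz
  · rintro _ ⟨z, hz, rfl⟩ _ ⟨w, hw, rfl⟩ hne
    refine Set.disjoint_left.2 fun u hu hu' => hne ?_
    rw [← h4 z hz u hu, ← h4 w hw u hu']
  · ext x
    constructor
    · rintro ⟨_, ⟨z, hz, rfl⟩, hx⟩
      exact h3 z hz hx
    · intro hx
      exact ⟨_, ⟨x, hx, rfl⟩, h2 x hx⟩

/-- Swapping holes with points of distinct tiles. -/
lemma good_swap {P Q : Type*} [PartialOrder P] [PartialOrder Q] {S H : Set Q}
    (C : Q → Set Q) (h1 : ∀ z ∈ S, IsCopy P (C z)) (h2 : ∀ z ∈ S, z ∈ C z)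
    (h3 : ∀ z ∈ S, C z ⊆ S) (h4 : ∀ z ∈ S, ∀ w ∈ C z, C w = C z)
    (hd : Disjoint S H) (φ : Q → Q) (hφ : ∀ h ∈ H, φ h ∈ S)
    (hinj : ∀ h ∈ H, ∀ h' ∈ H, φ h' ∈ C (φ h) → h = h')
    (hc : ∀ h ∈ H, IsCopy P (insert h (C (φ h) \ {φ h}))) :
    PartitionedIntoCopies P ((S ∪ H) \ φ '' H) := by
  have hdis : ∀ z ∈ S, ∀ w ∈ S, ∀ u, u ∈ C z → u ∈ C w → C z = C w := by
    intro z hz w hw u hu hu'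
    rw [← h4 z hz u hu, ← h4 w hw u hu']
  have hSH : ∀ z ∈ S, z ∉ H := fun z hz hz' => Set.disjoint_left.1 hd hz hz'
  refine ⟨{A | ∃ h ∈ H, A = insert h (C (φ h) \ {φ h})} ∪
    {A | ∃ z ∈ S, (∀ h ∈ H, φ h ∉ C z) ∧ A = C z}, ?_, ?_, ?_⟩
  · rintro A (⟨h, hh, rfl⟩ | ⟨z, hz, -, rfl⟩)
    · exact hc h hh
    · exact h1 z hz
  · have key : ∀ h ∈ H, ∀ z ∈ S, (∀ h ∈ H, φ h ∉ C z) →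
        Disjoint (insert h (C (φ h) \ {φ h})) (C z) := by
      intro h hh z hz hno
      refine Set.disjoint_left.2 fun u hu hu' => ?_
      rcases hu with rfl | ⟨hu, -⟩
      · exact hSH _ (h3 z hz hu') hh
      · have := hdis _ (hφ h hh) _ hz u hu hu'
        exact hno h hh (this ▸ h2 _ (hφ h hh))
    rintro A (⟨h, hh, rfl⟩ | ⟨z, hz, hz', rfl⟩) B (⟨h', hh', rfl⟩ | ⟨w, hw, hw', rfl⟩) hne
    · refine Set.disjoint_left.2 fun u hu hu' => ?_
      have hne' : h ≠ h' := by rintro rfl; exact hne rfl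
      rcases hu with rfl | ⟨hu, -⟩
      · rcases hu' with rfl | ⟨hu', -⟩
        · exact hne' rfl
        · exact hSH _ (h3 _ (hφ h' hh') hu') hh
      · rcases hu' with rfl | ⟨hu', -⟩
        · exact hSH _ (h3 _ (hφ h hh) hu) hh'
        · have := hdis _ (hφ h hh) _ (hφ h' hh') u hu hu'
          exact hne' (hinj h hh h' hh' (this ▸ h2 _ (hφ h' hh')))
    · exact key h hh w hw hw'
    · exact (key h' hh' z hz hz').symm
    · refine Set.disjoint_left.2 fun u hu hu' => hne (hdis z hz w hw u hu hu')
  · ext x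
    constructor
    · rintro ⟨A, (⟨h, hh, rfl⟩ | ⟨z, hz, hz', rfl⟩), hx⟩
      · rcases hx with rfl | ⟨hx, hx'⟩
        · refine ⟨Or.inr hh, ?_⟩
          rintro ⟨h', hh', rfl⟩
          exact hSH _ (hφ h' hh') hh
        · refine ⟨Or.inl (h3 _ (hφ h hh) hx), ?_⟩
          rintro ⟨h', hh', rfl⟩
          obtain rfl := hinj h hh h' hh' hx
          exact hx' rfl
      · refine ⟨Or.inl (h3 _ hz hx), ?_⟩
        rintro ⟨h', hh', rfl⟩
        exact hz' h' hh' hx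
    · rintro ⟨hx | hx, hx'⟩
      · by_cases hex : ∃ h ∈ H, φ h ∈ C x
        · obtain ⟨h, hh, hhx⟩ := hex
          refine ⟨_, Or.inl ⟨h, hh, rfl⟩, Or.inr ⟨?_, ?_⟩⟩
          · rw [h4 x hx _ hhx]; exact h2 x hx
          · rintro rfl
            exact hx' ⟨h, hh, rfl⟩
        · push Not at hex
          exact ⟨_, Or.inr ⟨x, hx, hex, rfl⟩, h2 x hx⟩
      · exact ⟨_, Or.inl ⟨x, hx, rfl⟩, Or.inl rfl⟩

/-- Disjoint unions. -/
lemma good_iUnion {P Q ι : Type*} [PartialOrder P] [PartialOrder Q] (S : ι → Set Q)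
    (hd : ∀ i j x, x ∈ S i → x ∈ S j → i = j) (h : ∀ i, PartitionedIntoCopies P (S i)) :
    PartitionedIntoCopies P (⋃ i, S i) := by
  choose 𝒞 h1 h2 h3 using h
  have hsub : ∀ i, ∀ A ∈ 𝒞 i, ∀ x ∈ A, x ∈ S i := by
    intro i A hA x hx
    rw [← h3 i]; exact ⟨A, hA, hx⟩
  refine ⟨⋃ i, 𝒞 i, ?_, ?_, ?_⟩
  · intro A hA
    obtain ⟨i, hi⟩ := Set.mem_iUnion.1 hA
    exact h1 i A hi
  · intro A hA B hB hne
    obtain ⟨i, hi⟩ := Set.mem_iUnion.1 hA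
    obtain ⟨j, hj⟩ := Set.mem_iUnion.1 hB
    refine Set.disjoint_left.2 fun u hu hu' => ?_
    obtain rfl := hd i j u (hsub i A hi u hu) (hsub j B hj u hu')
    exact Set.disjoint_left.1 (h2 i hi hj hne) hu hu'
  · rw [Set.sUnion_iUnion]
    simp only [h3]

lemma good_image {P Q Q' : Type*} [PartialOrder P] [PartialOrder Q] [PartialOrder Q']
    {S : Set Q} (h : PartitionedIntoCopies P S) (g : Q ↪o Q') :
    PartitionedIntoCopies P (g '' S) := by
  obtain ⟨𝒞, h1, h2, rfl⟩ := h
  refine ⟨(fun A => g '' A) '' 𝒞, ?_, ?_, ?_⟩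
  · rintro _ ⟨A, hA, rfl⟩
    exact isCopy_image (h1 A hA) g
  · rintro _ ⟨A, hA, rfl⟩ _ ⟨B, hB, rfl⟩ hne
    have : A ≠ B := by rintro rfl; exact hne rfl
    exact (Set.disjoint_image_iff g.injective).2 (h2 hA hB this)
  · rw [Set.sUnion_image, Set.sUnion_eq_biUnion, Set.image_iUnion₂]

lemma good_copy {P Q : Type*} [PartialOrder P] [PartialOrder Q] {A : Set Q}
    (h : IsCopy P A) : PartitionedIntoCopies P A :=
  ⟨{A}, by simpa using h, by simp, by simp⟩

/-- Replacing the least element of a copy by something smaller. -/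
lemma swap_bot {P Q : Type*} [PartialOrder P] [PartialOrder Q] (f : P ↪o Q) (b : P)
    (hb : ∀ p, b ≤ p) (h : Q) (hh : h ≤ f b) :
    IsCopy P (insert h (Set.range f \ {f b})) := by
  classical
  have hle : ∀ p, h ≤ f p := fun p => hh.trans (f.le_iff_le.2 (hb p))
  have hnot : ∀ p, p ≠ b → ¬ f p ≤ h := by
    intro p hp hle'
    exact hp (le_antisymm (f.le_iff_le.1 (hle'.trans hh)) (hb p))
  have hmap : ∀ {p q}, update f b h p ≤ update f b h q ↔ p ≤ q := by
    intro p q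
    by_cases hp : p = b <;> by_cases hq : q = b
    · subst hp; subst hq; simp
    · subst hp; simp [hq, hle, hb]
    · subst hq
      simp only [update_of_ne hp, update_self, hnot p hp, false_iff]
      exact fun h => hp (le_antisymm h (hb p))
    · simp [hp, hq]
  have := isCopy_range (OrderEmbedding.ofMapLEIff (update f b h) (fun p q => hmap))
  convert this using 1
  ext x
  simp only [Set.mem_insert_iff, Set.mem_sdiff, Set.mem_range, Set.mem_singleton_iff,
    OrderEmbedding.coe_ofMapLEIff]
  constructor
  · rintro (rfl | ⟨⟨p, rfl⟩, hp⟩)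
    · exact ⟨b, by simp⟩
    · refine ⟨p, update_of_ne ?_ _ _⟩
      rintro rfl; exact hp rfl
  · rintro ⟨p, rfl⟩
    by_cases hp : p = b
    · subst hp; simp
    · right; simp [hp]

/-- Replacing the greatest element of a copy by something larger. -/
lemma swap_top {P Q : Type*} [PartialOrder P] [PartialOrder Q] (f : P ↪o Q) (b : P)
    (hb : ∀ p, p ≤ b) (h : Q) (hh : f b ≤ h) :
    IsCopy P (insert h (Set.range f \ {f b})) := by
  obtain ⟨e⟩ := swap_bot (P := Pᵒᵈ) (Q := Qᵒᵈ) f.dual (OrderDual.toDual b)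
    (fun p => hb (OrderDual.ofDual p)) (OrderDual.toDual h) hh
  exact ⟨{ toEquiv := (OrderDual.toDual.trans e.toEquiv), map_rel_iff' := e.map_rel_iff }⟩

end GridPart

namespace GridPart

set_option linter.unusedSectionVars false

open Function

/-- The tile of a packing containing a given point. -/
def tileOf {P X J : Type*} (f : J → P → X) (x : X) : Set X :=
  {x' | ∃ i p q, x = f i p ∧ x' = f i q}

lemma tileOf_eq {P X J : Type*} (f : J → P → X) (hf : ∀ i j p q, f i p = f j q → i = j)
    (i : J) (p : P) : tileOf f (f i p) = Set.range (f i) := by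
  ext x
  constructor
  · rintro ⟨j, p', q, h, rfl⟩
    obtain rfl := hf _ _ _ _ h
    exact ⟨q, rfl⟩
  · rintro ⟨q, rfl⟩
    exact ⟨i, p, q, rfl, rfl⟩

/-- A choice of an element of a set, depending only on the set. -/
noncomputable def pick {ι : Type*} [Nonempty ι] (N : Set ι) : ι :=
  open Classical in if h : N.Nonempty then h.choose else Classical.arbitrary ι

lemma pick_mem {ι : Type*} [Nonempty ι] {N : Set ι} (h : N.Nonempty) : pick N ∈ N := by
  unfold pick
  rw [dif_pos h]
  exact h.choose_spec

section
variable {P X Y J J' ι : Type*} [DecidableEq ι] [Nonempty ι]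

/-- Coordinates at which a point is covered. -/
def cov (f : J → P → X) (x : ι → X) : Set ι := {j | ∃ i p, f i p = x j}

/-- The tile of a point of `(ι → X) × Y`. -/
def bigTile (f : J → P → X) (g : J' → P → Y) (z : (ι → X) × Y) : Set ((ι → X) × Y) :=
  {w | ((cov f z.1).Nonempty ∧ w.2 = z.2 ∧
      ∃ x' ∈ tileOf f (z.1 (pick (cov f z.1))), w.1 = update z.1 (pick (cov f z.1)) x') ∨
    (¬ (cov f z.1).Nonempty ∧ w.1 = z.1 ∧ w.2 ∈ tileOf g z.2)}

/-- The covered part. -/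
def bigCov (f : J → P → X) (g : J' → P → Y) : Set ((ι → X) × Y) :=
  {z | (cov f z.1).Nonempty ∨ ∃ i p, g i p = z.2}

lemma cov_update (f : J → P → X) (x : ι → X) (j : ι) (hj : j ∈ cov f x) (i : J) (p : P) :
    cov f (update x j (f i p)) = cov f x := by
  ext j'
  by_cases h : j' = j
  · subst h
    simp only [hj, iff_true]
    exact ⟨i, p, by simp⟩
  · simp [cov, h]

variable [PartialOrder P] [PartialOrder X] [PartialOrder Y]

/-- embedding along one coordinate -/
def lineEmb (x : ι → X) (y : Y) (j : ι) : X ↪o (ι → X) × Y :=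
  OrderEmbedding.ofMapLEIff (fun a => (update x j a, y)) (by
    intro a b
    simp only [Prod.mk_le_mk, le_refl, and_true]
    simp)

/-- embedding along the last coordinate -/
def lastEmb (x : ι → X) : Y ↪o (ι → X) × Y :=
  OrderEmbedding.ofMapLEIff (fun a => (x, a)) (by
    intro a b
    simp [Prod.mk_le_mk])

lemma bigTile_line (f : J → P → X) (g : J' → P → Y) (hf : ∀ i j p q, f i p = f j q → i = j)
    (z : (ι → X) × Y) (h : (cov f z.1).Nonempty) (i : J) (p : P)
    (hip : f i p = z.1 (pick (cov f z.1))) :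
    bigTile f g z = Set.range (fun q => lineEmb z.1 z.2 (pick (cov f z.1)) (f i q)) := by
  ext w
  simp only [bigTile, h, not_true, false_and, or_false, true_and, Set.mem_ofPred_eq, ← hip,
    tileOf_eq f hf, Set.mem_range]
  constructor
  · rintro ⟨h1, x', ⟨q, rfl⟩, h2⟩
    exact ⟨q, Prod.ext h2.symm h1.symm⟩
  · rintro ⟨q, rfl⟩
    exact ⟨rfl, _, ⟨q, rfl⟩, rfl⟩

lemma bigTile_last (f : J → P → X) (g : J' → P → Y) (hg : ∀ i j p q, g i p = g j q → i = j)
    (z : (ι → X) × Y) (h : ¬ (cov f z.1).Nonempty) (i : J') (p : P)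
    (hip : g i p = z.2) :
    bigTile f g z = Set.range (fun q => lastEmb z.1 (g i q)) := by
  ext w
  simp only [bigTile, h, not_false_iff, false_and, false_or, true_and, Set.mem_ofPred_eq, ← hip,
    tileOf_eq g hg, Set.mem_range]
  constructor
  · rintro ⟨h1, ⟨q, hq⟩⟩
    exact ⟨q, Prod.ext h1.symm hq⟩
  · rintro ⟨q, rfl⟩
    exact ⟨rfl, _, rfl⟩

lemma bigTile_props (f : J → P ↪o X) (g : J' → P ↪o Y)
    (hf : ∀ i j p q, f i p = f j q → i = j) (hg : ∀ i j p q, g i p = g j q → i = j)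
    (z : (ι → X) × Y) (hz : z ∈ bigCov (fun i => f i) (fun i => g i)) :
    IsCopy P (bigTile (fun i => f i) (fun i => g i) z) ∧
    z ∈ bigTile (fun i => f i) (fun i => g i) z ∧
    bigTile (fun i => f i) (fun i => g i) z ⊆ bigCov (fun i => f i) (fun i => g i) ∧
    ∀ w ∈ bigTile (fun i => f i) (fun i => g i) z,
      bigTile (fun i => f i) (fun i => g i) w = bigTile (fun i => f i) (fun i => g i) z := by
  set F : J → P → X := fun i => f i with hF
  set G : J' → P → Y := fun i => g i with hG
  by_cases h : (cov F z.1).Nonempty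
  · have hm := pick_mem h
    obtain ⟨i, p, hip⟩ := hm
    have e := bigTile_line F G hf z h i p hip
    refine ⟨?_, ?_, ?_, ?_⟩
    · rw [e]
      exact isCopy_range ((f i).trans (lineEmb z.1 z.2 (pick (cov F z.1))))
    · rw [e]
      refine ⟨p, ?_⟩
      simp [lineEmb, hip]
    · rw [e]
      rintro _ ⟨q, rfl⟩
      left
      change (cov F (update z.1 (pick (cov F z.1)) (F i q))).Nonempty
      rw [cov_update F _ _ (pick_mem h)]
      exact h
    · intro w hw
      have hw' := hw
      rw [e] at hw
      obtain ⟨q, rfl⟩ := hw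
      have hc : cov F (lineEmb z.1 z.2 (pick (cov F z.1)) (F i q)).1 = cov F z.1 :=
        cov_update F _ _ (pick_mem h) i q
      have e2 := bigTile_line F G hf (lineEmb z.1 z.2 (pick (cov F z.1)) (F i q))
        (by rw [hc]; exact h) i q (by rw [hc]; simp [lineEmb])
      rw [e2, e, hc]
      congr 1
      ext q' : 1
      simp [lineEmb]
  · have hz' : ∃ i p, G i p = z.2 := hz.resolve_left h
    obtain ⟨i, p, hip⟩ := hz'
    have e := bigTile_last F G hg z h i p hip
    refine ⟨?_, ?_, ?_, ?_⟩
    · rw [e]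
      exact isCopy_range ((g i).trans (lastEmb z.1))
    · rw [e]
      refine ⟨p, ?_⟩
      simp [lastEmb, hip]
    · rw [e]
      rintro _ ⟨q, rfl⟩
      right
      exact ⟨i, q, rfl⟩
    · intro w hw
      rw [e] at hw
      obtain ⟨q, rfl⟩ := hw
      have e2 := bigTile_last F G hg (lastEmb z.1 (G i q)) h i q rfl
      rw [e2, e]
      rfl

end

/-- The main deletion lemma: the pieces `Zs k` are disjoint and, removing any family of pieces
whose number equals the number of uncovered points of `Y`, leaves a tileable set. -/
lemma deletion {P X Y J J' K G : Type*} [PartialOrder P] [PartialOrder X] [PartialOrder Y]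
    [Fintype K] [Fintype G] [AddCommGroup G]
    (f : J → P ↪o X) (g : J' → P ↪o Y)
    (hf : ∀ i j p q, f i p = f j q → i = j) (hg : ∀ i j p q, g i p = g j q → i = j)
    (b t : P) (hb : ∀ p, b ≤ p) (ht : ∀ p, p ≤ t)
    (hsw : ∀ x, (∃ i, x ≤ f i b) ∨ (∃ i, f i t ≤ x))
    (yb yt : Y) (hyb : ∀ y, yb ≤ y) (hyt : ∀ y, y ≤ yt)
    (idx : X → G) (hidx : Injective idx) :
    ∃ Zs : K → Set ((K × G → X) × Y),
      (∀ i j z, z ∈ Zs i → z ∈ Zs j → i = j) ∧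
      ∀ I : Set K, Nonempty ({y : Y // ¬ ∃ j p, g j p = y} ≃ I) →
        PartitionedIntoCopies P (⋃ k ∈ I, Zs k)ᶜ := by
  classical
  have hsw' : ∀ x, ∃ (i : J) (p : P) (y' : Y), (p = b ∧ x ≤ f i b ∧ y' = yt) ∨
      (p = t ∧ f i t ≤ x ∧ y' = yb) := by
    intro x
    rcases hsw x with ⟨i, hi⟩ | ⟨i, hi⟩
    · exact ⟨i, b, yt, Or.inl ⟨rfl, hi, rfl⟩⟩
    · exact ⟨i, t, yb, Or.inr ⟨rfl, hi, rfl⟩⟩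
  choose si sp sy hs using hsw'
  set F : J → P → X := fun i => f i with hF
  set H : J' → P → Y := fun i => g i with hH
  let jj : K → (K × G → X) → K × G := fun k e => (k, ∑ i, idx (e i))
  let mv : K → (K × G → X) → (K × G → X) × Y := fun k e =>
    (update e (jj k e) (f (si (e (jj k e))) (sp (e (jj k e)))), sy (e (jj k e)))
  have hcov : ∀ k e, ¬ (cov F e).Nonempty → cov F (mv k e).1 = {jj k e} := by
    intro k e he
    ext j
    by_cases hj : j = jj k e
    · subst hj
      simp only [Set.mem_singleton_iff, iff_true]
      exact ⟨si (e (jj k e)), sp (e (jj k e)), by simp [mv, hF]⟩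
    · simp only [Set.mem_singleton_iff, hj, iff_false]
      intro hm
      apply he
      refine ⟨j, ?_⟩
      simpa [cov, mv, hj] using hm
  refine ⟨fun k => {z | ∃ e, ¬ (cov F e).Nonempty ∧ z = mv k e}, ?_, ?_⟩
  · rintro i j z ⟨e, he, rfl⟩ ⟨e', he', h⟩
    have h1 := hcov i e he
    rw [h, hcov j e' he'] at h1
    have := Set.singleton_injective h1
    exact (congrArg Prod.fst this).symm
  · rintro I ⟨a⟩
    by_cases hne : Nonempty (K × G)
    swap
    · -- no pieces at all
      have hK : IsEmpty K := by
        by_contra hK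
        rw [not_isEmpty_iff] at hK
        obtain ⟨k⟩ := hK
        exact hne ⟨(k, 0)⟩
      have hcov' : ∀ y : Y, ∃ j p, g j p = y := by
        intro y
        by_contra hy
        exact hK.elim (a ⟨y, hy⟩).1
      have : IsEmpty (K × G) := by simpa using hne
      have hgood : PartitionedIntoCopies P (Set.univ : Set ((K × G → X) × Y)) := by
        refine good_of_fun (fun z => {w | w.1 = z.1 ∧ w.2 ∈ tileOf H z.2}) ?_ ?_ ?_ ?_
        · intro z _
          obtain ⟨j, p, hjp⟩ := hcov' z.2
          have h1 : {w : (K × G → X) × Y | w.1 = z.1 ∧ w.2 ∈ tileOf H z.2} =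
              Set.range ((g j).trans (lastEmb z.1)) := by
            rw [← hjp]
            ext w
            have := tileOf_eq H hg j p
            simp only [hH] at this
            simp only [Set.mem_ofPred_eq, hH, this]
            constructor
            · rintro ⟨h1, q, h2⟩
              exact ⟨q, Prod.ext h1.symm h2⟩
            · rintro ⟨q, rfl⟩
              exact ⟨rfl, q, rfl⟩
          rw [h1]
          exact isCopy_range _
        · intro z _
          obtain ⟨j, p, hjp⟩ := hcov' z.2
          exact ⟨rfl, j, p, p, hjp.symm, hjp.symm⟩
        · intro z _
          exact Set.subset_univ _
        · rintro z - w ⟨h1, j, p, q, h2, h3⟩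
          rw [h1, h2, h3]
          have e1 := tileOf_eq H hg j p
          have e2 := tileOf_eq H hg j q
          rw [e1, e2]
      convert hgood
      simp
    have hprops := bigTile_props (ι := K × G) f g hf hg
    set HH : Set ((K × G → X) × Y) := (bigCov F H)ᶜ with hHH
    have hmem : ∀ z, z ∈ HH ↔ ¬ (cov F z.1).Nonempty ∧ ¬ ∃ i p, H i p = z.2 := by
      intro z
      simp only [hHH, bigCov, Set.mem_compl_iff, Set.mem_ofPred_eq, not_or]
    let φ : (K × G → X) × Y → (K × G → X) × Y := fun z =>
      if h : ¬ ∃ j p, g j p = z.2 then mv (a ⟨z.2, h⟩).1 z.1 else z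
    have hφ : ∀ z ∈ HH, ∃ h : ¬ ∃ j p, g j p = z.2, φ z = mv (a ⟨z.2, h⟩).1 z.1 := by
      intro z hz
      have h2 := ((hmem z).1 hz).2
      exact ⟨h2, dif_pos h2⟩
    -- the tile of a moved point
    have htile : ∀ k e, ¬ (cov F e).Nonempty → bigTile F H (mv k e) =
        Set.range ((f (si (e (jj k e)))).trans (lineEmb e (sy (e (jj k e))) (jj k e))) := by
      intro k e he
      have hc := hcov k e he
      have hn : (cov F (mv k e).1).Nonempty := by rw [hc]; exact Set.singleton_nonempty _
      have hp : pick (cov F (mv k e).1) = jj k e := by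
        have := pick_mem hn
        rw [hc] at this ⊢
        simpa using this
      have := bigTile_line F H hf (mv k e) hn (si (e (jj k e))) (sp (e (jj k e)))
        (by rw [hp]; simp [mv, hF])
      rw [this, hp]
      congr 1
      ext q : 1
      simp [lineEmb, mv, hF]
    have hsub := good_swap (P := P) (S := bigCov F H) (H := HH) (bigTile F H)
      (fun z hz => (hprops z hz).1) (fun z hz => (hprops z hz).2.1)
      (fun z hz => (hprops z hz).2.2.1) (fun z hz => (hprops z hz).2.2.2)
      disjoint_compl_right φ ?_ ?_ ?_
    · convert hsub using 1
      rw [hHH, Set.union_compl_self, ← Set.compl_eq_univ_sdiff]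
      congr 1
      ext w
      simp only [Set.mem_iUnion, Set.mem_ofPred_eq, exists_prop, Set.mem_image]
      constructor
      · rintro ⟨k, hk, e, he, rfl⟩
        have hy := (a.symm ⟨k, hk⟩).2
        refine ⟨(e, (a.symm ⟨k, hk⟩).1), (hmem _).2 ⟨he, hy⟩, ?_⟩
        simp only [φ]
        rw [dif_pos hy]
        simp
      · rintro ⟨z, hz, rfl⟩
        obtain ⟨h, e⟩ := hφ z hz
        exact ⟨_, (a ⟨z.2, h⟩).2, z.1, ((hmem z).1 hz).1, e⟩
    · intro z hz
      obtain ⟨h, e⟩ := hφ z hz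
      rw [e]
      left
      rw [hcov _ _ ((hmem z).1 hz).1]
      exact Set.singleton_nonempty _
    · intro z hz z' hz' hzz
      obtain ⟨h, e⟩ := hφ z hz
      obtain ⟨h', e'⟩ := hφ z' hz'
      have he := ((hmem z).1 hz).1
      have he' := ((hmem z').1 hz').1
      rw [e, e', htile _ _ he] at hzz
      obtain ⟨q, hq⟩ := hzz
      set k := (a ⟨z.2, h⟩).1 with hk
      set k' := (a ⟨z'.2, h'⟩).1 with hk'
      have hx : update z.1 (jj k z.1) (F (si (z.1 (jj k z.1))) q) = (mv k' z'.1).1 :=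
        congrArg Prod.fst hq
      have hj : jj k z.1 = jj k' z'.1 := by
        have h1 := hcov k' z'.1 he'
        rw [← hx] at h1
        have : jj k z.1 ∈ cov F (update z.1 (jj k z.1) (F (si (z.1 (jj k z.1))) q)) :=
          ⟨si (z.1 (jj k z.1)), q, by simp⟩
        rw [h1] at this
        exact this
      have hkk : k = k' := congrArg Prod.fst hj
      have hsum : ∑ i, idx (z.1 i) = ∑ i, idx (z'.1 i) := congrArg Prod.snd hj
      have hoff : ∀ j, j ≠ jj k z.1 → z.1 j = z'.1 j := by
        intro j hjne
        have := congrFun hx j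
        rw [update_of_ne hjne] at this
        rw [this]
        simp only [mv]
        rw [update_of_ne (by rw [← hj]; exact hjne)]
      have hon : z.1 (jj k z.1) = z'.1 (jj k z.1) := by
        apply hidx
        rw [← Finset.add_sum_erase _ _ (Finset.mem_univ (jj k z.1)),
          ← Finset.add_sum_erase (a := jj k z.1) Finset.univ (fun i => idx (z'.1 i))
            (Finset.mem_univ _)] at hsum
        have hrest : ∑ x ∈ Finset.univ.erase (jj k z.1), idx (z.1 x) =
            ∑ x ∈ Finset.univ.erase (jj k z.1), idx (z'.1 x) := by
          refine Finset.sum_congr rfl fun x hx => ?_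
          rw [hoff x (Finset.ne_of_mem_erase hx)]
        rw [hrest] at hsum
        exact add_right_cancel hsum
      have h1 : z.1 = z'.1 := by
        funext j
        by_cases hjj : j = jj k z.1
        · rw [hjj]; exact hon
        · exact hoff j hjj
      have h2 : z.2 = z'.2 := by
        have : a ⟨z.2, h⟩ = a ⟨z'.2, h'⟩ := Subtype.ext hkk
        have := a.injective this
        exact congrArg Subtype.val this
      exact Prod.ext h1 h2
    · intro z hz
      obtain ⟨h, e⟩ := hφ z hz
      have he := ((hmem z).1 hz).1
      rw [e]
      set k := (a ⟨z.2, h⟩).1 with hk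
      rw [htile _ _ he]
      set x := z.1 (jj k z.1) with hx
      have hmv : mv k z.1 = ((f (si x)).trans (lineEmb z.1 (sy x) (jj k z.1))) (sp x) := rfl
      rw [hmv]
      rcases hs x with ⟨h1, h2, h3⟩ | ⟨h1, h2, h3⟩
      · rw [h1]
        apply swap_bot _ _ hb
        change z ≤ (update z.1 (jj k z.1) (f (si x) b), sy x)
        refine ⟨?_, ?_⟩
        · simp only [le_update_iff]
          exact ⟨h2, fun _ _ => le_rfl⟩
        · rw [h3]; exact hyt _
      · rw [h1]
        apply swap_top _ _ ht
        change (update z.1 (jj k z.1) (f (si x) t), sy x) ≤ z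
        refine ⟨?_, ?_⟩
        · simp only [update_le_iff]
          exact ⟨h2, fun _ _ => le_rfl⟩
        · rw [h3]; exact hyb _

/-- The abstract tiling theorem. -/
theorem abstract_tiling {P X Y V J J' K G : Type*} [PartialOrder P] [PartialOrder X]
    [PartialOrder Y] [PartialOrder V] [Fintype K] [Fintype G] [AddCommGroup G]
    (f : J → P ↪o X) (g : J' → P ↪o Y)
    (hf : ∀ i j p q, f i p = f j q → i = j) (hg : ∀ i j p q, g i p = g j q → i = j)
    (b t : P) (hb : ∀ p, b ≤ p) (ht : ∀ p, p ≤ t)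
    (hsw : ∀ x, (∃ i, x ≤ f i b) ∨ (∃ i, f i t ≤ x))
    (yb yt : Y) (hyb : ∀ y, yb ≤ y) (hyt : ∀ y, y ≤ yt)
    (idx : X → G) (hidx : Injective idx)
    (A : K → P ↪o V)
    (hA : ∀ v, Nonempty ({y : Y // ¬ ∃ j p, g j p = y} ≃ {k : K | ∃ p, A k p = v})) :
    PartitionedIntoCopies P (Set.univ : Set (V × ((K × G → X) × Y))) := by
  obtain ⟨Zs, hd, hgood⟩ := deletion (K := K) f g hf hg b t hb ht hsw yb yt hyb hyt idx hidx
  let e1 : ((K × G → X) × Y) → V ↪o V × ((K × G → X) × Y) := fun z =>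
    OrderEmbedding.ofMapLEIff (fun v => (v, z)) (by intro a b; simp [Prod.mk_le_mk])
  let e2 : V → ((K × G → X) × Y) ↪o V × ((K × G → X) × Y) := fun v =>
    OrderEmbedding.ofMapLEIff (fun z => (v, z)) (by intro a b; simp [Prod.mk_le_mk])
  let S : ((Σ k : K, Zs k) ⊕ V) → Set (V × ((K × G → X) × Y)) := fun s =>
    match s with
    | Sum.inl ⟨k, z⟩ => e1 z.1 '' Set.range (A k)
    | Sum.inr v => e2 v '' (⋃ k ∈ {k : K | ∃ p, A k p = v}, Zs k)ᶜ
  have hS : (Set.univ : Set (V × ((K × G → X) × Y))) = ⋃ s, S s := by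
    symm
    rw [Set.eq_univ_iff_forall]
    rintro ⟨v, z⟩
    rw [Set.mem_iUnion]
    by_cases h : z ∈ ⋃ k ∈ {k : K | ∃ p, A k p = v}, Zs k
    · simp only [Set.mem_iUnion, Set.mem_ofPred_eq, exists_prop] at h
      obtain ⟨k, ⟨p, hp⟩, hz⟩ := h
      exact ⟨Sum.inl ⟨k, ⟨z, hz⟩⟩, v, ⟨p, hp⟩, rfl⟩
    · exact ⟨Sum.inr v, z, h, rfl⟩
  rw [hS]
  apply good_iUnion
  · rintro (⟨k, z, hz⟩ | v) (⟨k', z', hz'⟩ | v') x h h'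
    · obtain ⟨u, hu, rfl⟩ := h
      obtain ⟨u', hu', h'⟩ := h'
      obtain rfl : z' = z := congrArg Prod.snd h'
      obtain rfl := hd _ _ _ hz hz'
      rfl
    · exfalso
      obtain ⟨u, ⟨p, hu⟩, rfl⟩ := h
      obtain ⟨u', hu', h'⟩ := h'
      obtain rfl : u' = z := congrArg Prod.snd h'
      obtain rfl : v' = u := congrArg Prod.fst h'
      apply hu'
      simp only [Set.mem_iUnion, Set.mem_ofPred_eq, exists_prop]
      exact ⟨k, ⟨p, hu⟩, hz⟩
    · exfalso
      obtain ⟨u, ⟨p, hu⟩, rfl⟩ := h'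
      obtain ⟨u', hu', h'⟩ := h
      obtain rfl : u' = z' := congrArg Prod.snd h'
      obtain rfl : v = u := congrArg Prod.fst h'
      apply hu'
      simp only [Set.mem_iUnion, Set.mem_ofPred_eq, exists_prop]
      exact ⟨k', ⟨p, hu⟩, hz'⟩
    · obtain ⟨u, hu, rfl⟩ := h
      obtain ⟨u', hu', h'⟩ := h'
      obtain rfl : v' = v := congrArg Prod.fst h'
      rfl
  · rintro (⟨k, z, hz⟩ | v)
    · exact good_image (good_copy (isCopy_range (A k))) (e1 z)
    · exact good_image (hgood _ (hA v)) (e2 v)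

end GridPart

namespace GridPart

open Function

/-! An exact cover of the Boolean lattice with constant multiplicity. -/

lemma centralBinom_sq (m : ℕ) : (Nat.centralBinom m) ^ 2 * (2 * m + 1) ≤ 16 ^ m := by
  induction m with
  | zero => simp
  | succ m ih =>
    have h := Nat.succ_mul_centralBinom_succ m
    have h2 : (m + 1) ^ 2 * ((Nat.centralBinom (m + 1)) ^ 2 * (2 * (m + 1) + 1)) ≤
        (m + 1) ^ 2 * 16 ^ (m + 1) := by
      calc (m + 1) ^ 2 * ((Nat.centralBinom (m + 1)) ^ 2 * (2 * (m + 1) + 1))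
          = ((m + 1) * Nat.centralBinom (m + 1)) ^ 2 * (2 * m + 3) := by ring
        _ = (2 * (2 * m + 1) * Nat.centralBinom m) ^ 2 * (2 * m + 3) := by rw [h]
        _ = ((Nat.centralBinom m) ^ 2 * (2 * m + 1)) * (4 * (2 * m + 1) * (2 * m + 3)) := by ring
        _ ≤ 16 ^ m * (4 * (2 * m + 1) * (2 * m + 3)) := Nat.mul_le_mul_right _ ih
        _ ≤ 16 ^ m * (16 * (m + 1) ^ 2) := by
            apply Nat.mul_le_mul_left
            nlinarith
        _ = (m + 1) ^ 2 * 16 ^ (m + 1) := by ring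
    exact Nat.le_of_mul_le_mul_left h2 (by positivity)

lemma choose_bound (n j : ℕ) : n ^ 2 * Nat.choose (2 * n ^ 4) j ≤ 2 ^ (2 * n ^ 4) := by
  have h1 := Nat.choose_le_centralBinom j (n ^ 4)
  have h2 := centralBinom_sq (n ^ 4)
  refine (Nat.mul_le_mul_left _ h1).trans ?_
  rw [← Nat.pow_le_pow_iff_left (n := 2) (by norm_num)]
  calc (n ^ 2 * (n ^ 4).centralBinom) ^ 2 = (n ^ 4).centralBinom ^ 2 * n ^ 4 := by ring
    _ ≤ (n ^ 4).centralBinom ^ 2 * (2 * n ^ 4 + 1) := Nat.mul_le_mul_left _ (by omega)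
    _ ≤ 16 ^ (n ^ 4) := h2
    _ = (2 ^ (2 * n ^ 4)) ^ 2 := by
      rw [show (16 : ℕ) = 2 ^ 4 by norm_num, ← pow_mul, ← pow_mul]
      congr 1
      ring

lemma emb_of_ranks {P : Type*} [PartialOrder P] [Fintype P] (b t : P) (hb : ∀ p, b ≤ p)
    (ht : ∀ p, p ≤ t) (k : ℕ) (ρ : P → ℕ) (h1 : ∀ p q, p < q → ρ p + Fintype.card P ≤ ρ q)
    (h2 : ∀ p, ρ p < Fintype.card P + k) :
    ∃ f : P ↪o Finset ({p : P // p ≠ b} ⊕ Fin k), ∀ p, (f p).card = ρ p := by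
  classical
  let D : P → Finset {p : P // p ≠ b} := fun p => Finset.univ.filter (fun q => q.1 ≤ p)
  have hcard : Fintype.card {p : P // p ≠ b} = Fintype.card P - 1 := by
    rw [Fintype.card_subtype_compl, Fintype.card_subtype_eq]
  have hpos : 0 < Fintype.card P := Fintype.card_pos_iff.2 ⟨b⟩
  have hD : ∀ p, (D p).card ≤ Fintype.card P - 1 := by
    intro p
    rw [← hcard]
    exact Finset.card_le_univ _
  have hDb : D b = ∅ := by
    simp only [D, Finset.filter_eq_empty_iff]
    intro q _ hq
    exact q.2 (le_antisymm hq (hb _))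
  have hDt : (D t).card = Fintype.card P - 1 := by
    rw [← hcard, ← Finset.card_univ]
    congr 1
    simp [D, ht]
  have hDρ : ∀ p, (D p).card ≤ ρ p := by
    intro p
    by_cases hp : p = b
    · subst hp; simp [hDb]
    · have := h1 b p (lt_of_le_of_ne (hb p) (Ne.symm hp))
      have := hD p
      omega
  have hk : ∀ p, ρ p - (D p).card ≤ k := by
    intro p
    by_cases hp : p = t
    · subst hp
      have := h2 p
      omega
    · have := h1 p t (lt_of_le_of_ne (ht p) hp)
      have := h2 t
      omega
  let E : ℕ → Finset (Fin k) := fun h => Finset.univ.filter (fun q => q.1 < h)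
  have hE : ∀ h, h ≤ k → (E h).card = h := by
    intro h hh
    simp only [E, Fin.card_filter_val_lt]
    omega
  have hmono : ∀ p q, p ≤ q → ρ p - (D p).card ≤ ρ q - (D q).card := by
    intro p q hpq
    rcases hpq.eq_or_lt with rfl | hlt
    · rfl
    · have := h1 p q hlt
      have := hD q
      omega
  let f : P → Finset ({p : P // p ≠ b} ⊕ Fin k) := fun p =>
    (D p).disjSum (E (ρ p - (D p).card))
  have hle : ∀ p q, f p ≤ f q ↔ p ≤ q := by
    intro p q
    constructor
    · intro h
      by_cases hp : p = b
      · subst hp; exact hb q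
      · have : Sum.inl ⟨p, hp⟩ ∈ f p := by simp [f, D]
        have := h this
        simpa [f, D] using this
    · intro h
      refine Finset.disjSum_mono ?_ ?_
      · intro x hx
        simp only [D, Finset.mem_filter, Finset.mem_univ, true_and] at hx ⊢
        exact hx.trans h
      · intro x hx
        simp only [E, Finset.mem_filter, Finset.mem_univ, true_and] at hx ⊢
        exact hx.trans_le (hmono p q h)
  refine ⟨OrderEmbedding.ofMapLEIff f hle, fun p => ?_⟩
  change (f p).card = _
  rw [Finset.card_disjSum, hE _ (hk p)]
  have := hDρ p
  omega

lemma exists_enum (κ : Type*) [Fintype κ] [DecidableEq κ] :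
    ∃ w : Fin (2 ^ Fintype.card κ) ≃ Finset κ, Monotone (fun u => (w u).card) := by
  have g : Fin (2 ^ Fintype.card κ) ≃ Finset κ :=
    (Fintype.equivFinOfCardEq (by simp)).symm
  exact ⟨(Tuple.sort (fun u => (g u).card)).trans g, Tuple.monotone_sort (fun u => (g u).card)⟩

lemma enum_gap {κ : Type*} [Fintype κ] [DecidableEq κ] {N : ℕ} (w : Fin N ≃ Finset κ)
    (hw : Monotone (fun u => (w u).card)) (n : ℕ)
    (hn : ∀ j, n ^ 2 * Nat.choose (Fintype.card κ) j ≤ N) (u u' : Fin N) (huu : u ≤ u')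
    (h : N < n * (u'.1 - u.1 + 1)) : (w u).card + n ≤ (w u').card := by
  by_contra hlt
  push Not at hlt
  have hsub : (Finset.Icc u u').map w.toEmbedding ⊆
      (Finset.range n).biUnion (fun j => Finset.powersetCard ((w u).card + j) Finset.univ) := by
    intro s hs
    simp only [Finset.mem_map, Finset.mem_Icc] at hs
    obtain ⟨v, ⟨h1, h2⟩, rfl⟩ := hs
    have h3 := hw h1
    have h4 := hw h2
    simp only at h3 h4
    simp only [Finset.mem_biUnion, Finset.mem_range, Finset.mem_powersetCard]
    refine ⟨(w v).card - (w u).card, by omega, Finset.subset_univ _, ?_⟩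
    simp only [Equiv.coe_toEmbedding]
    omega
  have hc := Finset.card_le_card hsub
  rw [Finset.card_map, Fin.card_Icc] at hc
  have h5 : n * ((Finset.range n).biUnion
      (fun j => Finset.powersetCard ((w u).card + j) (Finset.univ : Finset κ))).card ≤ N := by
    rcases Nat.eq_zero_or_pos n with rfl | hpos
    · simp
    have : ∀ j ∈ Finset.range n, n ^ 2 *
      (Finset.powersetCard ((w u).card + j) (Finset.univ : Finset κ)).card ≤ N := by
      intro j _
      rw [Finset.card_powersetCard, Finset.card_univ]
      exact hn _
    have h6 := Finset.card_biUnion_le (s := Finset.range n)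
      (t := fun j => Finset.powersetCard ((w u).card + j) (Finset.univ : Finset κ))
    have h7 := Finset.sum_le_sum this
    rw [← Finset.mul_sum, Finset.sum_const, Finset.card_range, smul_eq_mul] at h7
    have h8 : n * (n * ∑ j ∈ Finset.range n,
        (Finset.powersetCard ((w u).card + j) (Finset.univ : Finset κ)).card) ≤ n * N := by
      calc _ = n ^ 2 * ∑ j ∈ Finset.range n,
        (Finset.powersetCard ((w u).card + j) (Finset.univ : Finset κ)).card := by ring
        _ ≤ _ := h7
    exact (Nat.mul_le_mul_left n h6).trans (Nat.le_of_mul_le_mul_left h8 hpos)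
  have h9 : n * (u'.1 - u.1 + 1) ≤ n * (u'.1 + 1 - u.1) := Nat.mul_le_mul_left _ (by
    have : u.1 ≤ u'.1 := huu
    omega)
  have := Nat.mul_le_mul_left n hc
  omega

lemma exists_perm_map {κ : Type*} [Fintype κ] [DecidableEq κ] (A B : Finset κ)
    (h : A.card = B.card) : ∃ τ : Equiv.Perm κ, A.map τ.toEmbedding = B := by
  let e : {x // x ∈ A} ≃ {x // x ∈ B} := Finset.equivOfCardEq h
  refine ⟨e.extendSubtype, ?_⟩
  apply Finset.eq_of_subset_of_card_le
  · intro x hx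
    obtain ⟨a, ha, rfl⟩ := Finset.mem_map.1 hx
    exact e.extendSubtype_mem a ha
  · rw [Finset.card_map, h]

lemma perm_count {κ : Type*} [Fintype κ] [DecidableEq κ] (A B s : Finset κ)
    (h : A.card = B.card) :
    (∑ σ : Equiv.Perm κ, if A.map σ.toEmbedding = s then 1 else 0) =
    ∑ σ : Equiv.Perm κ, if B.map σ.toEmbedding = s then 1 else 0 := by
  obtain ⟨τ, rfl⟩ := exists_perm_map A B h
  symm
  refine Fintype.sum_equiv (Equiv.mulRight τ) _ _ ?_
  intro σ
  rw [Finset.map_map]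
  rfl

universe u

theorem boolean_cover (P : Type u) [PartialOrder P] [Fintype P] (b t : P) (hb : ∀ p, b ≤ p)
    (ht : ∀ p, p ≤ t) :
    ∃ (κ K : Type u) (_ : Fintype κ) (_ : Fintype K) (A : K → P ↪o Finset κ) (r : ℕ),
      0 < r ∧ ∀ s, Nat.card {k // ∃ p, A k p = s} = r := by
  classical
  set n := Fintype.card P with hn
  have hpos : 0 < n := Fintype.card_pos_iff.2 ⟨b⟩
  set k' := 2 * n ^ 4 - (n - 1) with hk'
  let κ := {p : P // p ≠ b} ⊕ Fin k'
  have hn4 : n ≤ n ^ 4 := Nat.le_self_pow (by norm_num) n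
  have hcard : Fintype.card κ = 2 * n ^ 4 := by
    rw [Fintype.card_sum, Fintype.card_subtype_compl, Fintype.card_subtype_eq, Fintype.card_fin]
    omega
  obtain ⟨N, hN, w, hw⟩ : ∃ N, N = 2 ^ Fintype.card κ ∧ ∃ w : Fin N ≃ Finset κ,
      Monotone (fun u => (w u).card) := ⟨_, rfl, exists_enum κ⟩
  have hbound : ∀ j, n ^ 2 * Nat.choose (Fintype.card κ) j ≤ N := by
    intro j
    rw [hN, hcard]
    exact choose_bound n j
  -- a linear extension
  obtain ⟨l, hl⟩ : ∃ l : P ≃ Fin n, Monotone l := by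
    have : Fintype (LinearExtension P) := inferInstanceAs (Fintype P)
    have e : LinearExtension P ≃o Fin n :=
      (Fintype.orderIsoFinOfCardEq (LinearExtension P) (by
        rw [hn]; exact Fintype.card_congr (Equiv.refl P))).symm
    exact ⟨(Equiv.refl P : P ≃ LinearExtension P).trans e.toEquiv,
      fun p q hpq => e.monotone (toLinearExtension.monotone hpq)⟩
  -- the evenly spaced positions
  let Ψ : Fin N × P ≃ Finset κ × Fin n :=
    (Equiv.prodComm _ _).trans <| (Equiv.prodCongr l (Equiv.refl _)).trans <|
      finProdFinEquiv.trans <| (finCongr (Nat.mul_comm n N)).trans <|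
      finProdFinEquiv.symm.trans (Equiv.prodCongr w (Equiv.refl _))
  have hΨ : ∀ θ p, ∃ u : Fin N, (Ψ (θ, p)).1 = w u ∧ u.1 = (θ.1 + N * (l p).1) / n := by
    intro θ p
    exact ⟨_, rfl, rfl⟩
  have hgap : ∀ θ p q, p < q → (Ψ (θ, p)).1.card + n ≤ (Ψ (θ, q)).1.card := by
    intro θ p q hpq
    obtain ⟨u, h1, h2⟩ := hΨ θ p
    obtain ⟨u', h1', h2'⟩ := hΨ θ q
    have hlt : (l p).1 < (l q).1 := by
      have := hl hpq.le
      have hne : l p ≠ l q := fun h => hpq.ne (l.injective h)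
      exact Fin.lt_def.1 (lt_of_le_of_ne this hne)
    have hmul : N * (l p).1 + N ≤ N * (l q).1 := by
      have : N * ((l p).1 + 1) ≤ N * (l q).1 := Nat.mul_le_mul_left _ hlt
      linarith
    have hle : u.1 ≤ u'.1 := by
      rw [h2, h2']
      apply Nat.div_le_div_right
      omega
    rw [h1, h1']
    refine enum_gap w hw n hbound u u' hle ?_
    have e1 : n * u.1 ≤ θ.1 + N * (l p).1 := by rw [h2]; exact Nat.mul_div_le _ _
    have e2 : θ.1 + N * (l q).1 < n * u'.1 + n := by
      rw [h2']
      exact Nat.lt_mul_div_succ _ hpos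
    have e3 : n * (u'.1 - u.1 + 1) + n * u.1 = n * u'.1 + n := by
      rw [← Nat.mul_add, ← Nat.mul_succ]
      congr 1
      omega
    omega
  have hsmall : ∀ θ p, (Ψ (θ, p)).1.card < n + k' := by
    intro θ p
    have := Finset.card_le_univ (Ψ (θ, p)).1
    rw [hcard] at this
    omega
  choose F hF using fun θ => emb_of_ranks b t hb ht k' (fun p => (Ψ (θ, p)).1.card)
    (hgap θ) (hsmall θ)
  let A : Equiv.Perm κ × Fin N → P ↪o Finset κ := fun x =>
    (F x.2).trans (Finset.mapEmbedding x.1.toEmbedding)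
  refine ⟨κ, Equiv.Perm κ × Fin N, inferInstance, inferInstance, A,
    Fintype.card (Equiv.Perm κ) * n, Nat.mul_pos Fintype.card_pos hpos, ?_⟩
  intro s
  rw [Nat.card_eq_fintype_card, Fintype.card_subtype, Finset.card_filter]
  have step1 : ∀ x : Equiv.Perm κ × Fin N, (if ∃ p, A x p = s then 1 else 0) =
      ∑ p : P, if (F x.2 p).map x.1.toEmbedding = s then 1 else 0 := by
    intro x
    split_ifs with h
    · obtain ⟨p, hp⟩ := h
      rw [Finset.sum_eq_single p]
      · exact (if_pos hp).symm
      · intro q _ hq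
        refine if_neg fun h => hq ?_
        exact (A x).injective (show A x q = A x p from (h.trans hp.symm))
      · simp
    · symm
      refine Finset.sum_eq_zero fun p _ => if_neg fun hp => h ⟨p, hp⟩
  rw [Finset.sum_congr rfl (fun x _ => step1 x), Fintype.sum_prod_type, Finset.sum_comm]
  have step2 : ∀ y : Fin N, (∑ σ : Equiv.Perm κ, ∑ p : P,
      if (F y p).map σ.toEmbedding = s then 1 else 0) =
      ∑ p : P, ∑ σ : Equiv.Perm κ,
        if ((Ψ (y, p)).1).map σ.toEmbedding = s then 1 else 0 := by
    intro y
    rw [Finset.sum_comm]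
    refine Finset.sum_congr rfl fun p _ => ?_
    exact perm_count _ _ _ (hF y p)
  rw [Finset.sum_congr rfl (fun y _ => step2 y)]
  rw [← Fintype.sum_prod_type' (fun y p => ∑ σ : Equiv.Perm κ,
    if ((Ψ (y, p)).1).map σ.toEmbedding = s then 1 else 0)]
  rw [Finset.sum_comm]
  have step3 : ∀ σ : Equiv.Perm κ, (∑ x : Fin N × P,
      if ((Ψ (x.1, x.2)).1).map σ.toEmbedding = s then 1 else 0) = n := by
    intro σ
    rw [Equiv.sum_comp Ψ (fun z => if z.1.map σ.toEmbedding = s then 1 else 0),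
      Fintype.sum_prod_type]
    have : ∀ B : Finset κ, (∑ _i : Fin n, if B.map σ.toEmbedding = s then 1 else 0) =
        if B = s.map σ.symm.toEmbedding then n else 0 := by
      intro B
      have hiff : B.map σ.toEmbedding = s ↔ B = s.map σ.symm.toEmbedding := by
        constructor
        · rintro rfl
          ext x; simp
        · rintro rfl
          ext x; simp
      simp only [hiff]
      split_ifs <;> simp
    rw [Finset.sum_congr rfl (fun B _ => this B)]
    rw [Finset.sum_eq_single (s.map σ.symm.toEmbedding)]
    · exact if_pos rfl
    · intro B _ hB
      exact if_neg hB
    · intro h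
      exact absurd (Finset.mem_univ _) h
  rw [Finset.sum_congr rfl (fun σ _ => step3 σ)]
  simp

end GridPart

namespace GridPart

open Function

/-! The three ingredients inside the grid, and the assembly. -/

/-- The small cube with corner `2 β`. -/
noncomputable def cube {κ : Type*} {n : ℕ} (β : κ → Fin n) [DecidableEq κ] :
    Finset κ ↪o (κ → Fin (2 * n)) :=
  OrderEmbedding.ofMapLEIff (fun s c => ⟨2 * (β c).1 + if c ∈ s then 1 else 0, by
    have := (β c).2
    split_ifs <;> omega⟩) (by
    intro s s'
    constructor
    · intro h c hc
      have := h c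
      simp only [Fin.mk_le_mk, if_pos hc] at this
      by_contra hc'
      rw [if_neg hc'] at this
      omega
    · intro h c
      simp only [Fin.mk_le_mk]
      by_cases hc : c ∈ s
      · rw [if_pos hc, if_pos (h hc)]
      · rw [if_neg hc]
        omega)

lemma cube_val {κ : Type*} {n : ℕ} (β : κ → Fin n) [DecidableEq κ] (s : Finset κ) (c : κ) :
    (cube β s c).1 = 2 * (β c).1 + if c ∈ s then 1 else 0 := rfl

lemma cube_inj {κ : Type*} {n : ℕ} {β β' : κ → Fin n} [DecidableEq κ] {s s' : Finset κ}
    (h : cube β s = cube β' s') : β = β' ∧ s = s' := by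
  have hb : β = β' := by
    ext c
    have := congrArg Fin.val (congrFun h c)
    rw [cube_val, cube_val] at this
    split_ifs at this <;> omega
  subst hb
  exact ⟨rfl, (cube β).injective h⟩

lemma cube_surj {κ : Type*} [Fintype κ] {n : ℕ} [DecidableEq κ] (v : κ → Fin (2 * n)) :
    ∃ (β : κ → Fin n) (s : Finset κ), cube β s = v := by
  refine ⟨fun c => ⟨(v c).1 / 2, by have := (v c).2; omega⟩,
    Finset.univ.filter fun c => (v c).1 % 2 = 1, ?_⟩
  ext c
  rw [cube_val]
  simp only [Finset.mem_filter, Finset.mem_univ, true_and]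
  split_ifs <;> omega

lemma v_piece {P κ K : Type*} [PartialOrder P] [Fintype κ] (n : ℕ)
    (A : K → P ↪o Finset κ) (r : ℕ) (h : ∀ s, Nat.card {k // ∃ p, A k p = s} = r) (g : ℕ) :
    ∃ B : ((κ → Fin n) × K) × Fin g → P ↪o (κ → Fin (2 * n)),
      ∀ v, Nat.card {k // ∃ p, B k p = v} = r * g := by
  classical
  refine ⟨fun k => (A k.1.2).trans (cube k.1.1), fun v => ?_⟩
  obtain ⟨β, s, rfl⟩ := cube_surj v
  have e : {k : ((κ → Fin n) × K) × Fin g // ∃ p, ((A k.1.2).trans (cube k.1.1)) p = cube β s} ≃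
      {k : K // ∃ p, A k p = s} × Fin g :=
    { toFun := fun k => (⟨k.1.1.2, by
        obtain ⟨k, p, hp⟩ := k
        exact ⟨p, (cube_inj hp).2⟩⟩, k.1.2)
      invFun := fun k => ⟨((β, k.1.1), k.2), by
        obtain ⟨⟨k, p, hp⟩, i⟩ := k
        exact ⟨p, by simp [hp]⟩⟩
      left_inv := by
        rintro ⟨⟨⟨β', k⟩, i⟩, p, hp⟩
        have := (cube_inj hp).1
        simp only at this
        subst this
        rfl
      right_inv := by
        rintro ⟨⟨k, p, hp⟩, i⟩
        rfl }
  rw [Nat.card_congr e, Nat.card_prod, h, Nat.card_fin]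

lemma x_piece {P : Type*} [PartialOrder P] [Fintype P] (n : ℕ) (hn : Fintype.card P = n)
    (h2 : 2 ≤ n) (b t : P) :
    ∃ (J : Type) (f : J → P ↪o (Fin (2 * n) → Fin (2 * n))),
      (∀ i j p q, f i p = f j q → i = j) ∧
      ∀ x, (∃ i, x ≤ f i b) ∨ (∃ i, f i t ≤ x) := by
  classical
  let I := {I : Finset (Fin (2 * n)) // I.card = n}
  have hE : ∀ i : I, Nonempty ({c // c ∈ i.1} ≃ P) := fun i =>
    ⟨Fintype.equivOfCardEq (by rw [Fintype.card_coe, i.2, hn])⟩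
  have E := fun i => Classical.choice (hE i)
  let val : I × Bool → P → Fin (2 * n) → ℕ := fun i p c =>
    if hc : c ∈ i.1.1 then (if E i.1 ⟨c, hc⟩ ≤ p then n else n - 1)
    else (if i.2 then 0 else 2 * n - 1)
  have hin : ∀ i p c (hc : c ∈ i.1.1), val i p c = if E i.1 ⟨c, hc⟩ ≤ p then n else n - 1 :=
    fun i p c hc => dif_pos hc
  have hout : ∀ i p c, c ∉ i.1.1 → val i p c = if i.2 then 0 else 2 * n - 1 :=
    fun i p c hc => dif_neg hc
  have hlt : ∀ i p c, val i p c < 2 * n := by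
    intro i p c
    by_cases hc : c ∈ i.1.1
    · rw [hin i p c hc]
      split_ifs <;> omega
    · rw [hout i p c hc]
      split_ifs <;> omega
  have hmono : ∀ i p q, (∀ c, val i p c ≤ val i q c) ↔ p ≤ q := by
    intro i p q
    constructor
    · intro h
      have := h ((E i.1).symm p).1
      rw [hin i p _ ((E i.1).symm p).2, hin i q _ ((E i.1).symm p).2] at this
      simp only [Subtype.coe_eta, Equiv.apply_symm_apply, le_refl, if_true] at this
      by_contra hpq
      rw [if_neg hpq] at this
      omega
    · intro hpq c
      by_cases hc : c ∈ i.1.1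
      · rw [hin i p c hc, hin i q c hc]
        split_ifs with h1 h2
        · exact le_rfl
        · exact absurd (h1.trans hpq) h2
        · omega
        · exact le_rfl
      · rw [hout i p c hc, hout i q c hc]
  let f : I × Bool → P ↪o (Fin (2 * n) → Fin (2 * n)) := fun i =>
    OrderEmbedding.ofMapLEIff (fun p c => ⟨val i p c, hlt i p c⟩) (hmono i)
  have hfv : ∀ i p c, (f i p c).1 = val i p c := fun _ _ _ => rfl
  refine ⟨I × Bool, f, ?_, ?_⟩
  · intro i j p q h
    have hv : ∀ c, val i p c = val j q c := fun c => by rw [← hfv, ← hfv, h]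
    have hex : ∀ i : I, ∃ c, c ∉ i.1 := by
      intro i
      by_contra! hcon
      have : i.1 = Finset.univ := Finset.eq_univ_of_forall hcon
      have h' := i.2
      rw [this, Finset.card_univ, Fintype.card_fin] at h'
      omega
    have hmem : ∀ i : I × Bool, ∀ p c, c ∈ i.1.1 ↔ (val i p c = n ∨ val i p c = n - 1) := by
      intro i p c
      constructor
      · intro hc
        rw [hin i p c hc]
        split_ifs <;> simp
      · intro hc
        by_contra hc'
        rw [hout i p c hc'] at hc
        split_ifs at hc <;> omega
    have h1 : i.1 = j.1 := by
      apply Subtype.ext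
      ext c
      rw [hmem i p, hmem j q, hv]
    refine Prod.ext h1 ?_
    obtain ⟨c, hc⟩ := hex i.1
    have := hv c
    rw [hout i p c hc, hout j q c (h1 ▸ hc)] at this
    cases hi : i.2 <;> cases hj : j.2 <;> simp_all <;> omega
  · intro x
    let S := Finset.univ.filter fun c => (x c).1 < n
    by_cases hS : n ≤ S.card
    · left
      obtain ⟨T, hT, hTc⟩ := Finset.exists_subset_card_eq hS
      refine ⟨(⟨T, hTc⟩, false), fun c => ?_⟩
      rw [Fin.le_def, hfv]
      by_cases hc : c ∈ T
      · rw [hin _ _ c hc]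
        have : (x c).1 < n := (Finset.mem_filter.1 (hT hc)).2
        split_ifs <;> omega
      · rw [hout _ _ c hc]
        have := (x c).2
        simp only [Bool.false_eq_true, if_false]
        omega
    · right
      have hS' : n ≤ Sᶜ.card := by
        rw [Finset.card_compl, Fintype.card_fin]
        omega
      obtain ⟨T, hT, hTc⟩ := Finset.exists_subset_card_eq hS'
      refine ⟨(⟨T, hTc⟩, true), fun c => ?_⟩
      rw [Fin.le_def, hfv]
      by_cases hc : c ∈ T
      · rw [hin _ _ c hc]
        have : ¬ (x c).1 < n := fun h =>
          Finset.mem_compl.1 (hT hc) (Finset.mem_filter.2 ⟨Finset.mem_univ _, h⟩)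
        split_ifs <;> omega
      · rw [hout _ _ c hc]
        simp

lemma y_piece {P : Type*} [PartialOrder P] [Fintype P] (n : ℕ) (hn : Fintype.card P = n)
    (h2 : 2 ≤ n) (r : ℕ) (hr : 0 < r) :
    ∃ (J : Type) (g : J → P ↪o ((P → Fin (2 * n)) × (Fin r → Fin (2 * n)))) (R : ℕ),
      (∀ i j p q, g i p = g j q → i = j) ∧
      Nat.card {y // ¬ ∃ j p, g j p = y} = r * R := by
  classical
  let q := (2 * n) ^ (n + r) / n % r
  have hq : q ≤ Fintype.card (Fin r → Fin (2 * n)) := by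
    have h1 : q < r := Nat.mod_lt _ hr
    have h3 : r < (2 * n) ^ r := Nat.lt_pow_self (by omega)
    simp only [Fintype.card_pi, Fintype.card_fin, Finset.prod_const, Finset.card_univ]
    omega
  obtain ⟨z⟩ : Nonempty (Fin q ↪ (Fin r → Fin (2 * n))) :=
    Embedding.nonempty_of_card_le (by simpa using hq)
  let D : P ↪o (P → Fin (2 * n)) := OrderEmbedding.ofMapLEIff
    (fun p c => ⟨if c ≤ p then 1 else 0, by split_ifs <;> omega⟩) (by
      intro p q
      constructor
      · intro h
        have := h p
        simp only [Fin.mk_le_mk, le_refl, if_true] at this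
        by_contra hpq
        rw [if_neg hpq] at this
        omega
      · intro hpq c
        simp only [Fin.mk_le_mk]
        split_ifs with h1 h2
        · exact le_rfl
        · exact absurd (h1.trans hpq) h2
        · omega
        · exact le_rfl)
  let g : Fin q → P ↪o ((P → Fin (2 * n)) × (Fin r → Fin (2 * n))) := fun j =>
    OrderEmbedding.ofMapLEIff (fun p => (D p, z j)) (by
      intro p p'
      simp [Prod.le_def])
  have hg : ∀ i p, g i p = (D p, z i) := fun _ _ => rfl
  have hdis : ∀ i j p q, g i p = g j q → i = j := by
    intro i j p q h
    rw [hg, hg, Prod.mk.injEq] at h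
    exact z.injective h.2
  refine ⟨Fin q, g, n * ((2 * n) ^ (n + r) / n / r), hdis, ?_⟩
  have hcov : Fintype.card {y // ∃ j p, g j p = y} = q * n := by
    have e : Fin q × P ≃ {y // ∃ j p, g j p = y} := Equiv.ofBijective
      (fun x => ⟨g x.1 x.2, x.1, x.2, rfl⟩) (by
        constructor
        · rintro ⟨i, p⟩ ⟨j, p'⟩ h
          have h' : g i p = g j p' := congrArg Subtype.val h
          have := hdis _ _ _ _ h'
          subst this
          rw [(g i).injective h']
        · rintro ⟨y, j, p, rfl⟩
          exact ⟨(j, p), rfl⟩)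
    rw [← Fintype.card_congr e, Fintype.card_prod, Fintype.card_fin, hn]
  rw [Nat.card_eq_fintype_card, Fintype.card_subtype_compl, hcov, Fintype.card_prod]
  simp only [Fintype.card_pi, Fintype.card_fin, Finset.prod_const, Finset.card_univ, hn]
  rw [← pow_add]
  have hdvd : n ∣ (2 * n) ^ (n + r) :=
    (Dvd.intro_left 2 rfl).trans (dvd_pow_self _ (by omega))
  have h1 : (2 * n) ^ (n + r) / n * n = (2 * n) ^ (n + r) := Nat.div_mul_cancel hdvd
  have h3 := Nat.mod_add_div ((2 * n) ^ (n + r) / n) r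
  have h4 : (2 * n) ^ (n + r) = q * n + r * (n * ((2 * n) ^ (n + r) / n / r)) := by
    calc (2 * n) ^ (n + r) = (2 * n) ^ (n + r) / n * n := h1.symm
      _ = (q + r * ((2 * n) ^ (n + r) / n / r)) * n := by rw [h3]
      _ = _ := by ring
  omega

/-- Being order isomorphic to a grid of side `m`. -/
def IsGrid (m : ℕ) (Q : Type*) [PartialOrder Q] : Prop :=
  ∃ d : ℕ, Nonempty (Q ≃o (Fin d → Fin m))

/-- Reindexing. -/
def reindex {α β M : Type*} [PartialOrder M] (e : α ≃ β) : (α → M) ≃o (β → M) where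
  toEquiv := Equiv.arrowCongr e (Equiv.refl M)
  map_rel_iff' := by
    intro f g
    constructor
    · intro h a
      have := h (e a)
      simpa using this
    · intro h b
      exact h _

/-- A product of two powers is a power. -/
def sumPow (α β M : Type*) [PartialOrder M] : ((α → M) × (β → M)) ≃o (α ⊕ β → M) where
  toEquiv := (Equiv.sumArrowEquivProdArrow α β M).symm
  map_rel_iff' := by
    intro f g
    constructor
    · intro h
      exact ⟨fun a => h (Sum.inl a), fun b => h (Sum.inr b)⟩
    · rintro ⟨h1, h2⟩ (a | b)
      · exact h1 a
      · exact h2 b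

/-- Currying. -/
def powPow (α β M : Type*) [PartialOrder M] : (α → β → M) ≃o (α × β → M) where
  toEquiv := (Equiv.curry α β M).symm
  map_rel_iff' := by
    intro f g
    constructor
    · intro h a b
      exact h (a, b)
    · rintro h ⟨a, b⟩
      exact h a b

lemma isGrid_of {m : ℕ} {Q α : Type*} [PartialOrder Q] [Finite α] (e : Q ≃o (α → Fin m)) :
    IsGrid m Q := by
  obtain ⟨d, ⟨e'⟩⟩ := Finite.exists_equiv_fin α
  exact ⟨d, ⟨e.trans (reindex e')⟩⟩

lemma isGrid_pow {m : ℕ} (α : Type*) [Finite α] : IsGrid m (α → Fin m) :=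
  isGrid_of (OrderIso.refl _)

lemma isGrid_prod {m : ℕ} {Q R : Type*} [PartialOrder Q] [PartialOrder R]
    (hQ : IsGrid m Q) (hR : IsGrid m R) : IsGrid m (Q × R) := by
  obtain ⟨d, ⟨e⟩⟩ := hQ
  obtain ⟨d', ⟨e'⟩⟩ := hR
  let p : (Q × R) ≃o ((Fin d → Fin m) × (Fin d' → Fin m)) :=
    { toEquiv := Equiv.prodCongr e.toEquiv e'.toEquiv
      map_rel_iff' := by
        intro x y
        simp [Prod.le_def] }
  exact isGrid_of (p.trans (sumPow _ _ _))

lemma good_iso {P Q R : Type*} [PartialOrder P] [PartialOrder Q] [PartialOrder R] (e : Q ≃o R)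
    (h : PartitionedIntoCopies P (Set.univ : Set Q)) :
    PartitionedIntoCopies P (Set.univ : Set R) := by
  have := good_image h e.toOrderEmbedding
  have h2 : e.toOrderEmbedding '' Set.univ = Set.univ := by
    rw [Set.image_univ]
    exact e.surjective.range_eq
  rwa [h2] at this

lemma good_prod {P Q Z : Type*} [PartialOrder P] [PartialOrder Q] [PartialOrder Z]
    (h : PartitionedIntoCopies P (Set.univ : Set Q)) :
    PartitionedIntoCopies P (Set.univ : Set (Q × Z)) := by
  let s : Z → Q ↪o Q × Z := fun z => OrderEmbedding.ofMapLEIff (fun x => (x, z)) (by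
    intro x y
    simp [Prod.le_def])
  have hs : ∀ z x, s z x = (x, z) := fun _ _ => rfl
  have := good_iUnion (P := P) (fun z => s z '' Set.univ) (by
    rintro i j x ⟨y, -, rfl⟩ ⟨y', -, h'⟩
    rw [hs, hs, Prod.mk.injEq] at h'
    exact h'.2.symm) (fun z => good_image h (s z))
  have h2 : (⋃ z, s z '' Set.univ) = Set.univ := by
    ext ⟨x, z⟩
    simp only [Set.mem_iUnion, Set.mem_univ, iff_true]
    exact ⟨z, x, trivial, rfl⟩
  rwa [h2] at this

lemma good_large {P Q : Type*} [PartialOrder P] [PartialOrder Q] {m : ℕ} (hQ : IsGrid m Q)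
    (h : PartitionedIntoCopies P (Set.univ : Set Q)) :
    ∃ d₀ : ℕ, ∀ d : ℕ, d₀ ≤ d →
      PartitionedIntoCopies P (Set.univ : Set (Fin d → Fin m)) := by
  obtain ⟨d₀, ⟨e⟩⟩ := hQ
  refine ⟨d₀, fun d hd => ?_⟩
  have h1 := good_prod (Z := Fin (d - d₀) → Fin m) (good_iso e h)
  exact good_iso ((sumPow _ _ _).trans
    (reindex (finSumFinEquiv.trans (finCongr (by omega))))) h1

theorem main_bounded {P : Type*} [PartialOrder P] [Fintype P] (n : ℕ) (hn : Fintype.card P = n)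
    (h2 : 2 ≤ n) (b t : P) (hb : ∀ p, b ≤ p) (ht : ∀ p, p ≤ t) :
    ∃ d₀ : ℕ, ∀ d : ℕ, d₀ ≤ d →
      PartitionedIntoCopies P (Set.univ : Set (Fin d → Fin (2 * n))) := by
  classical
  obtain ⟨κ, K, _, _, A, r, hr, hA⟩ := boolean_cover P b t hb ht
  obtain ⟨J', g, R, hg, hR⟩ := y_piece (P := P) n hn h2 r hr
  obtain ⟨J, f, hf, hsw⟩ := x_piece n hn h2 b t
  obtain ⟨B, hB⟩ := v_piece n A r hA R
  have : NeZero (2 * n) := ⟨by omega⟩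
  have key := abstract_tiling (G := Fin (2 * n) → ZMod (2 * n)) f g hf hg b t hb ht hsw
    (fun _ => 0, fun _ => 0) (fun _ => ⟨2 * n - 1, by omega⟩, fun _ => ⟨2 * n - 1, by omega⟩) (by
      intro y
      exact ⟨fun _ => Fin.zero_le _, fun _ => Fin.zero_le _⟩) (by
      intro y
      constructor
      · intro c
        have := (y.1 c).2
        rw [Fin.le_def]
        simp only
        omega
      · intro c
        have := (y.2 c).2
        rw [Fin.le_def]
        simp only
        omega) (fun x c => ((x c).1 : ZMod (2 * n))) (by
      intro x y h
      ext c
      have hc := congrFun h c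
      simp only at hc
      rw [ZMod.natCast_eq_natCast_iff', Nat.mod_eq_of_lt (x c).2, Nat.mod_eq_of_lt (y c).2] at hc
      exact hc) B (by
      intro v
      refine Finite.card_eq.1 ?_
      rw [hR]
      exact (hB v).symm)
  refine good_large ?_ key
  exact isGrid_prod (isGrid_pow _) (isGrid_prod
    (isGrid_of (powPow _ _ _)) (isGrid_prod (isGrid_pow _) (isGrid_pow _)))

lemma main_point {P : Type*} [PartialOrder P] [Fintype P] (hn : Fintype.card P = 1)
    {Q : Type*} [PartialOrder Q] : PartitionedIntoCopies P (Set.univ : Set Q) := by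
  obtain ⟨p, hp⟩ := Fintype.card_eq_one_iff.1 hn
  have hsub : Subsingleton P := ⟨fun x y => (hp x).trans (hp y).symm⟩
  refine ⟨Set.range fun x : Q => ({x} : Set Q), ?_, ?_, ?_⟩
  · rintro _ ⟨x, rfl⟩
    let f : P ↪o Q := OrderEmbedding.ofMapLEIff (fun _ => x) (by
      intro a b
      rw [Subsingleton.elim a b]
      simp)
    have hf : Set.range f = {x} := by
      ext y
      constructor
      · rintro ⟨_, rfl⟩
        rfl
      · intro hy
        exact ⟨p, (Set.mem_singleton_iff.1 hy).symm⟩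
    have := isCopy_range f
    rw [hf] at this
    exact this
  · rintro _ ⟨x, rfl⟩ _ ⟨y, rfl⟩ hxy
    refine Set.disjoint_singleton.2 fun h => hxy ?_
    rw [h]
  · ext x
    simp

end GridPart

/-- If a finite poset `P` has a unique maximal and a unique minimal element, then for all
sufficiently large `d` the grid `[2|P|]^d` (modelled as `Fin d → Fin (2 * |P|)` with the
componentwise order) can be partitioned into copies of `P`. -/
theorem grid_partition_into_copies (P : Type*) [PartialOrder P] [Fintype P]
    (hmax : ∃! x : P, IsMax x) (hmin : ∃! x : P, IsMin x) :
    ∃ d₀ : ℕ, ∀ d : ℕ, d₀ ≤ d →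
      PartitionedIntoCopies P
        (Set.univ : Set (Fin d → Fin (2 * Fintype.card P))) := by
  obtain ⟨t, htm, htu⟩ := hmax
  obtain ⟨b, hbm, hbu⟩ := hmin
  have ht : ∀ p, p ≤ t := by
    intro p
    obtain ⟨q, hpq, hq⟩ := Finite.exists_le_maximal (p := fun _ : P => True) (a := p) trivial
    have : IsMax q := fun y hy => hq.2 trivial hy
    exact htu q this ▸ hpq
  have hb : ∀ p, b ≤ p := by
    intro p
    obtain ⟨q, hpq, hq⟩ := Finite.exists_le_minimal (p := fun _ : P => True) (a := p) trivial
    have : IsMin q := fun y hy => hq.2 trivial hy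
    exact hbu q this ▸ hpq
  have hpos : 0 < Fintype.card P := Fintype.card_pos_iff.2 ⟨b⟩
  by_cases h1 : Fintype.card P = 1
  · exact ⟨0, fun d _ => GridPart.main_point h1⟩
  · exact GridPart.main_bounded _ rfl (by omega) b t hb ht
end
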